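/- Let Φ : ℝⁿ → ℝ be C¹, strictly convex, even, with Φ ≥ 0, Φ(0) = 0, Φ(x)/‖x‖ → ∞ at infinity. Assume (i) sup_{x} (1−α) Φ*(x/(1−α)) / Φ*(x) → 1 as α → 0⁺, and (ii) there exists A > 0 with x·∇Φ(x) ≤ (A+1)Φ(x) for all x. Then there exist constants C₁, C₂ ≥ 0 such that for every smooth enough g with ∫ e^g dμ_Φ = 1 and Ent_{μ_Φ}(e^g) ≥ 1, one has Ent_{μ_Φ}(e^g) ≤ C₁ ∫ Φ*(C₂ ∇g) e^g dμ_Φ, where μ_Φ(dx) = e^{-Φ(x)}dx/Z_Φ. -/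

import Mathlib

open MeasureTheory Real Filter Bornology
open scoped RealInnerProductSpace

/-- The Legendre (Fenchel) transform of `Φ`. -/
noncomputable def legendre {n : ℕ} (Φ : EuclideanSpace ℝ (Fin n) → ℝ)
    (y : EuclideanSpace ℝ (Fin n)) : ℝ :=
  ⨆ z, ⟪y, z⟫ - Φ z

/-- The entropy of `f` with respect to `μ`. -/
noncomputable def Ent {n : ℕ} (μ : Measure (EuclideanSpace ℝ (Fin n)))
    (f : EuclideanSpace ℝ (Fin n) → ℝ) : ℝ :=
  ∫ x, f x * Real.log (f x / ∫ y, f y ∂μ) ∂μ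

section Sobolev

variable {E : Type*} [NormedAddCommGroup E] [InnerProductSpace ℝ E] [FiniteDimensional ℝ E]

/-- Cutoff functions whose radial derivatives are bounded independently of the scale. -/
lemma exists_cutoff (E : Type*) [NormedAddCommGroup E] [InnerProductSpace ℝ E]
    [FiniteDimensional ℝ E] :
    ∃ K : ℝ, 0 ≤ K ∧ ∀ R : ℝ, 1 ≤ R → ∃ χ : E → ℝ, ContDiff ℝ 1 χ ∧ HasCompactSupport χ ∧
      (∀ x, 0 ≤ χ x) ∧ (∀ x, χ x ≤ 1) ∧ (∀ x, ‖x‖ ≤ R → χ x = 1) ∧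
      (∀ x, 2 * R ≤ ‖x‖ → χ x = 0) ∧ (∀ x, ‖fderiv ℝ χ x‖ ≤ K) ∧
      (∀ x, |fderiv ℝ χ x x| ≤ K) ∧ (∀ x, ‖x‖ < R → fderiv ℝ χ x = 0) := by
  let b : ContDiffBump (0 : E) := ⟨1, 2, one_pos, one_lt_two⟩
  have hb : ContDiff ℝ 1 b := b.contDiff
  have hcont : Continuous (fderiv ℝ b) := hb.continuous_fderiv one_ne_zero
  have hcs : HasCompactSupport (fderiv ℝ b) := b.hasCompactSupport.fderiv (𝕜 := ℝ)
  obtain ⟨K, hK⟩ := hcs.exists_bound_of_continuous hcont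
  have hK0 : 0 ≤ K := (norm_nonneg _).trans (hK 0)
  have hvan : ∀ y : E, 2 < ‖y‖ → fderiv ℝ b y = 0 := by
    intro y hy
    have : (b : E → ℝ) =ᶠ[nhds y] fun _ => (0 : ℝ) := by
      filter_upwards [(isOpen_lt continuous_const continuous_norm).mem_nhds hy] with z hz
      exact b.zero_of_le_dist (by simpa [b] using (le_of_lt hz))
    rw [this.fderiv_eq]; simp
  have hrad : ∀ y : E, |fderiv ℝ b y y| ≤ 2 * K := by
    intro y
    by_cases hy : 2 < ‖y‖
    · simp [hvan y hy]; exact hK0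
    · push Not at hy
      calc |fderiv ℝ b y y| ≤ ‖fderiv ℝ b y‖ * ‖y‖ := (fderiv ℝ b y).le_opNorm y
        _ ≤ K * 2 := by gcongr; exact hK y
        _ = 2 * K := by ring
  refine ⟨2 * K, by positivity, fun R hR => ?_⟩
  have hR0 : 0 < R := by linarith
  have hder : ∀ x : E, HasFDerivAt (fun x : E => b (R⁻¹ • x)) (R⁻¹ • fderiv ℝ b (R⁻¹ • x)) x := by
    intro x
    have h1 := ((hb.differentiable one_ne_zero) (R⁻¹ • x)).hasFDerivAt
    have h2 : HasFDerivAt (fun x : E => R⁻¹ • x) (R⁻¹ • ContinuousLinearMap.id ℝ E) x :=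
      (hasFDerivAt_id x).const_smul R⁻¹
    exact (h1.comp x h2).congr_fderiv (by ext v; simp)
  have hfd : ∀ x : E, fderiv ℝ (fun x : E => b (R⁻¹ • x)) x = R⁻¹ • fderiv ℝ b (R⁻¹ • x) :=
    fun x => (hder x).fderiv
  have hone : ∀ x : E, ‖x‖ ≤ R → b (R⁻¹ • x) = 1 := by
    intro x hx
    apply b.one_of_mem_closedBall
    simp [b, norm_smul, abs_of_pos hR0]
    rw [inv_mul_le_iff₀ hR0]; linarith
  have hzero : ∀ x : E, 2 * R ≤ ‖x‖ → b (R⁻¹ • x) = 0 := by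
    intro x hx
    apply b.zero_of_le_dist
    simp [b, norm_smul, abs_of_pos hR0]
    rw [le_inv_mul_iff₀ hR0]; linarith
  refine ⟨fun x => b (R⁻¹ • x), hb.comp (contDiff_const_smul _), ?_, fun x => b.nonneg,
    fun x => b.le_one, hone, hzero, ?_, ?_, ?_⟩
  · apply HasCompactSupport.of_support_subset_isCompact (isCompact_closedBall (0 : E) (2 * R))
    intro x hx
    by_contra h
    simp only [Metric.mem_closedBall, dist_zero_right, not_le] at h
    exact hx (hzero x h.le)
  · intro x
    rw [hfd, norm_smul, norm_inv, Real.norm_of_nonneg hR0.le]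
    calc R⁻¹ * ‖fderiv ℝ b (R⁻¹ • x)‖ ≤ 1 * K := by
          gcongr
          · exact inv_le_one_of_one_le₀ hR
          · exact hK _
      _ ≤ 2 * K := by linarith
  · intro x
    rw [hfd]
    have := hrad (R⁻¹ • x)
    simpa using this
  · intro x hx
    have : (fun x : E => b (R⁻¹ • x)) =ᶠ[nhds x] fun _ => (1 : ℝ) := by
      filter_upwards [(isOpen_lt continuous_norm continuous_const).mem_nhds hx] with z hz
      exact hone z (le_of_lt hz)
    rw [this.fderiv_eq]; simp

variable [MeasurableSpace E] [BorelSpace E]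

/-- Gagliardo–Nirenberg–Sobolev for compactly supported functions, with the full `W^{1,1}` norm so
that it also covers dimensions `0` and `1`. It follows from the inequality on `E × ℝ²` applied to
`u(x) φ(t)`. -/
lemma sobolev_of_hasCompactSupport (μ : Measure E) [μ.IsAddHaarMeasure] :
    ∃ p : ℝ, 1 < p ∧ ∃ C : NNReal, ∀ u : E → ℝ, ContDiff ℝ 1 u → HasCompactSupport u →
      ∫⁻ x, ‖u x‖ₑ ^ p ∂μ ≤ C * (∫⁻ x, ‖u x‖ₑ ∂μ + ∫⁻ x, ‖fderiv ℝ u x‖ₑ ∂μ) ^ p := by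
  let d : ℝ := Module.finrank ℝ E
  have hd : 0 ≤ d := Nat.cast_nonneg _
  let φ : ContDiffBump (0 : ℝ × ℝ) := ⟨1, 2, one_pos, one_lt_two⟩
  have hφ : ContDiff ℝ 1 φ := φ.contDiff
  let p : ℝ := (d + 2) / (d + 1)
  have hp1 : 1 < p := by
    simp only [p]; rw [lt_div_iff₀ (by positivity)]; linarith
  have hp : Real.HolderConjugate (Module.finrank ℝ (E × (ℝ × ℝ)) : ℝ) p := by
    rw [Real.holderConjugate_comm, Real.holderConjugate_iff]
    refine ⟨hp1, ?_⟩
    have : (Module.finrank ℝ (E × (ℝ × ℝ)) : ℝ) = d + 2 := by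
      simp [d]
    rw [this]
    simp only [p]
    field_simp
    ring
  have hp0 : 0 < p := by linarith
  let a : ENNReal := ∫⁻ t, ‖φ t‖ₑ ^ p
  let M₁ : ENNReal := ∫⁻ t, ‖φ t‖ₑ
  let M₂ : ENNReal := ∫⁻ t, ‖fderiv ℝ φ t‖ₑ
  have hM₁ : M₁ ≠ ⊤ := (φ.continuous.integrable_of_hasCompactSupport φ.hasCompactSupport).2.ne
  have hM₂ : M₂ ≠ ⊤ := ((hφ.continuous_fderiv one_ne_zero).integrable_of_hasCompactSupport
    (φ.hasCompactSupport.fderiv (𝕜 := ℝ))).2.ne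
  have ha : a ≠ 0 := by
    have h1 : volume (Metric.closedBall (0 : ℝ × ℝ) 1) ≤ a := by
      calc volume (Metric.closedBall (0 : ℝ × ℝ) 1)
          = ∫⁻ t in Metric.closedBall (0 : ℝ × ℝ) 1, 1 := by simp
        _ ≤ ∫⁻ t in Metric.closedBall (0 : ℝ × ℝ) 1, ‖φ t‖ₑ ^ p := by
          apply setLIntegral_mono' Metric.isClosed_closedBall.measurableSet
          intro t ht
          rw [φ.one_of_mem_closedBall ht]; simp
        _ ≤ a := setLIntegral_le_lintegral _ _
    have h2 : 0 < volume (Metric.closedBall (0 : ℝ × ℝ) 1) :=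
      Metric.measure_closedBall_pos _ _ one_pos
    exact (h2.trans_le h1).ne'
  let C₀ := lintegralPowLePowLIntegralFDerivConst (μ.prod (volume : Measure (ℝ × ℝ))) p
  have hCtop : a⁻¹ * (C₀ * (M₁ + M₂) ^ p) ≠ ⊤ := by
    refine ENNReal.mul_ne_top (ENNReal.inv_ne_top.2 ha) (ENNReal.mul_ne_top ENNReal.coe_ne_top ?_)
    exact ENNReal.rpow_ne_top_of_nonneg hp0.le (ENNReal.add_ne_top.2 ⟨hM₁, hM₂⟩)
  refine ⟨p, hp1, (a⁻¹ * (C₀ * (M₁ + M₂) ^ p)).toNNReal, fun u hu hcu => ?_⟩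
  rw [ENNReal.coe_toNNReal hCtop]
  let w : E × (ℝ × ℝ) → ℝ := fun z => u z.1 * φ z.2
  have hw : ContDiff ℝ 1 w := (hu.comp contDiff_fst).mul (hφ.comp contDiff_snd)
  have hcw : HasCompactSupport w := by
    apply HasCompactSupport.of_support_subset_isCompact (hcu.isCompact.prod φ.hasCompactSupport.isCompact)
    intro z hz
    have := mul_ne_zero_iff.1 (show u z.1 * φ z.2 ≠ 0 from hz)
    exact ⟨subset_tsupport _ this.1, subset_tsupport _ this.2⟩
  have hfw : ∀ z, ‖fderiv ℝ w z‖ₑ ≤ ‖fderiv ℝ u z.1‖ₑ * ‖φ z.2‖ₑ + ‖u z.1‖ₑ * ‖fderiv ℝ φ z.2‖ₑ := by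
    intro z
    have h1 : HasFDerivAt (fun z : E × (ℝ × ℝ) => u z.1)
        ((fderiv ℝ u z.1).comp (ContinuousLinearMap.fst ℝ E (ℝ × ℝ))) z :=
      ((hu.differentiable one_ne_zero) z.1).hasFDerivAt.comp z hasFDerivAt_fst
    have h2 : HasFDerivAt (fun z : E × (ℝ × ℝ) => φ z.2)
        ((fderiv ℝ φ z.2).comp (ContinuousLinearMap.snd ℝ E (ℝ × ℝ))) z :=
      ((hφ.differentiable one_ne_zero) z.2).hasFDerivAt.comp z hasFDerivAt_snd
    rw [show fderiv ℝ w z = _ from (h1.mul h2).fderiv]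
    have key : ‖u z.1 • (fderiv ℝ φ z.2).comp (ContinuousLinearMap.snd ℝ E (ℝ × ℝ)) +
        φ z.2 • (fderiv ℝ u z.1).comp (ContinuousLinearMap.fst ℝ E (ℝ × ℝ))‖ ≤
        ‖fderiv ℝ u z.1‖ * ‖φ z.2‖ + ‖u z.1‖ * ‖fderiv ℝ φ z.2‖ := by
      refine (ContinuousLinearMap.opNorm_add_le _ _).trans ?_
      rw [norm_smul, norm_smul, add_comm, mul_comm ‖fderiv ℝ u z.1‖]
      gcongr
      · exact (ContinuousLinearMap.opNorm_comp_le _ _).trans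
          (mul_le_of_le_one_right (norm_nonneg _) (ContinuousLinearMap.norm_fst_le _ _ _))
      · exact (ContinuousLinearMap.opNorm_comp_le _ _).trans
          (mul_le_of_le_one_right (norm_nonneg _) (ContinuousLinearMap.norm_snd_le _ _ _))
    simp only [← ofReal_norm, ← ENNReal.ofReal_mul (norm_nonneg _)]
    rw [← ENNReal.ofReal_add (by positivity) (by positivity)]
    exact ENNReal.ofReal_le_ofReal key
  have hmain := lintegral_pow_le_pow_lintegral_fderiv (μ.prod (volume : Measure (ℝ × ℝ))) hw hcw hp
  have hmu : Measurable fun x => ‖u x‖ₑ := hu.continuous.enorm.measurable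
  have hmφ : Measurable fun x => ‖φ x‖ₑ := φ.continuous.enorm.measurable
  have hmu' : Measurable fun x => ‖fderiv ℝ u x‖ₑ := (hu.continuous_fderiv one_ne_zero).enorm.measurable
  have hmφ' : Measurable fun x => ‖fderiv ℝ φ x‖ₑ := (hφ.continuous_fderiv one_ne_zero).enorm.measurable
  have hleft : ∫⁻ z, ‖w z‖ₑ ^ p ∂(μ.prod (volume : Measure (ℝ × ℝ))) =
      (∫⁻ x, ‖u x‖ₑ ^ p ∂μ) * a := by
    rw [← lintegral_prod_mul (hmu.pow_const p).aemeasurable (hmφ.pow_const p).aemeasurable]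
    refine lintegral_congr fun z => ?_
    simp only [w, enorm_mul]
    rw [ENNReal.mul_rpow_of_nonneg _ _ hp0.le]
  have hright : ∫⁻ z, ‖fderiv ℝ w z‖ₑ ∂(μ.prod (volume : Measure (ℝ × ℝ))) ≤
      (M₁ + M₂) * (∫⁻ x, ‖u x‖ₑ ∂μ + ∫⁻ x, ‖fderiv ℝ u x‖ₑ ∂μ) := by
    calc _ ≤ ∫⁻ z : E × (ℝ × ℝ), ‖fderiv ℝ u z.1‖ₑ * ‖φ z.2‖ₑ + ‖u z.1‖ₑ * ‖fderiv ℝ φ z.2‖ₑ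
            ∂(μ.prod (volume : Measure (ℝ × ℝ))) := lintegral_mono hfw
      _ = (∫⁻ x, ‖fderiv ℝ u x‖ₑ ∂μ) * M₁ + (∫⁻ x, ‖u x‖ₑ ∂μ) * M₂ := by
        rw [lintegral_add_left, lintegral_prod_mul hmu'.aemeasurable hmφ.aemeasurable,
          lintegral_prod_mul hmu.aemeasurable hmφ'.aemeasurable]
        exact (hmu'.comp measurable_fst).mul (hmφ.comp measurable_snd)
      _ ≤ (∫⁻ x, ‖fderiv ℝ u x‖ₑ ∂μ) * (M₁ + M₂) + (∫⁻ x, ‖u x‖ₑ ∂μ) * (M₁ + M₂) := by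
        gcongr
        · exact le_self_add
        · exact le_add_self
      _ = _ := by ring
  have hatop : a ≠ ⊤ := by
    have : a ≤ M₁ := lintegral_mono fun t => by
      have h1 : ‖φ t‖ₑ ≤ 1 := by
        rw [← ofReal_norm, Real.norm_of_nonneg φ.nonneg]
        exact ENNReal.ofReal_le_one.2 φ.le_one
      calc ‖φ t‖ₑ ^ p ≤ ‖φ t‖ₑ ^ (1 : ℝ) := ENNReal.rpow_le_rpow_of_exponent_ge h1 hp1.le
        _ = ‖φ t‖ₑ := ENNReal.rpow_one _
    exact ne_top_of_le_ne_top hM₁ this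
  calc ∫⁻ x, ‖u x‖ₑ ^ p ∂μ = a⁻¹ * ((∫⁻ x, ‖u x‖ₑ ^ p ∂μ) * a) := by
        rw [mul_comm _ a, ← mul_assoc, ENNReal.inv_mul_cancel ha hatop, one_mul]
    _ ≤ a⁻¹ * (C₀ * ((M₁ + M₂) * (∫⁻ x, ‖u x‖ₑ ∂μ + ∫⁻ x, ‖fderiv ℝ u x‖ₑ ∂μ)) ^ p) := by
        rw [← hleft]
        exact mul_le_mul_right (hmain.trans (mul_le_mul_right
          (ENNReal.rpow_le_rpow hright hp0.le) _)) _
    _ = _ := by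
        rw [ENNReal.mul_rpow_of_nonneg _ _ hp0.le]
        ring

/-- The embedding of `W^{1,1}` in some `L^p`, `p > 1`, for `C¹` functions. -/
lemma sobolev_of_integrable (μ : Measure E) [μ.IsAddHaarMeasure] :
    ∃ p : ℝ, 1 < p ∧ ∃ C : ℝ, 0 ≤ C ∧ ∀ u : E → ℝ, ContDiff ℝ 1 u → Integrable u μ →
      Integrable (fderiv ℝ u) μ →
      Integrable (fun x => |u x| ^ p) μ ∧
      ∫ x, |u x| ^ p ∂μ ≤ C * (∫ x, |u x| ∂μ + ∫ x, ‖fderiv ℝ u x‖ ∂μ) ^ p := by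
  obtain ⟨p, hp1, C, hC⟩ := sobolev_of_hasCompactSupport μ
  obtain ⟨K, hK0, hK⟩ := exists_cutoff E
  have hp0 : 0 < p := by linarith
  refine ⟨p, hp1, C * (1 + K) ^ p, by positivity, fun u hu hiu hiu' => ?_⟩
  have hR : ∀ k : ℕ, (1 : ℝ) ≤ k + 1 := fun k => by have := Nat.cast_nonneg (α := ℝ) k; linarith
  choose χ hχ using fun k : ℕ => hK (k + 1) (hR k)
  set N : ℝ := ∫ x, |u x| ∂μ + ∫ x, ‖fderiv ℝ u x‖ ∂μ with hN
  have hN0 : 0 ≤ N := by positivity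
  have hstep : ∀ k, ∫⁻ x, ‖χ k x * u x‖ₑ ^ p ∂μ ≤ C * (ENNReal.ofReal ((1 + K) * N)) ^ p := by
    intro k
    obtain ⟨h1, h2, h3, h4, -, -, h7, -, -⟩ := hχ k
    refine (hC (fun x => χ k x * u x) (h1.mul hu) h2.mul_right).trans ?_
    have hb1 : ∀ x, ‖χ k x * u x‖ ≤ |u x| := fun x => by
      rw [norm_mul, Real.norm_of_nonneg (h3 x)]
      exact mul_le_of_le_one_left (abs_nonneg _) (h4 x)
    have hb2 : ∀ x, ‖fderiv ℝ (fun x => χ k x * u x) x‖ ≤ ‖fderiv ℝ u x‖ + K * |u x| := by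
      intro x
      rw [fderiv_fun_mul ((h1.differentiable one_ne_zero) x) ((hu.differentiable one_ne_zero) x)]
      refine (norm_add_le _ _).trans ?_
      rw [norm_smul, norm_smul, Real.norm_of_nonneg (h3 x), mul_comm K]
      gcongr
      · exact mul_le_of_le_one_left (norm_nonneg _) (h4 x)
      · exact le_rfl
      · exact h7 x
    have e1 : ∫⁻ x, ‖χ k x * u x‖ₑ ∂μ ≤ ENNReal.ofReal (∫ x, |u x| ∂μ) := by
      rw [ofReal_integral_eq_lintegral_ofReal hiu.abs (ae_of_all _ fun x => abs_nonneg _)]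
      exact lintegral_mono fun x => by
        rw [← ofReal_norm]; exact ENNReal.ofReal_le_ofReal (hb1 x)
    have e2 : ∫⁻ x, ‖fderiv ℝ (fun x => χ k x * u x) x‖ₑ ∂μ ≤
        ENNReal.ofReal (∫ x, ‖fderiv ℝ u x‖ + K * |u x| ∂μ) := by
      have hi : Integrable (fun x => ‖fderiv ℝ u x‖ + K * |u x|) μ :=
        hiu'.norm.add (hiu.abs.const_mul K)
      have hn : ∀ x, 0 ≤ ‖fderiv ℝ u x‖ + K * |u x| := fun x => by positivity
      rw [ofReal_integral_eq_lintegral_ofReal hi (ae_of_all _ hn)]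
      exact lintegral_mono fun x => by
        rw [← ofReal_norm]; exact ENNReal.ofReal_le_ofReal (hb2 x)
    gcongr
    refine (add_le_add e1 e2).trans ?_
    rw [← ENNReal.ofReal_add (by positivity) (by positivity)]
    apply ENNReal.ofReal_le_ofReal
    rw [integral_add hiu'.norm (hiu.abs.const_mul K), integral_const_mul, hN]
    have : 0 ≤ ∫ x, ‖fderiv ℝ u x‖ ∂μ := by positivity
    nlinarith
  have hlim : ∀ x, Tendsto (fun k => ‖χ k x * u x‖ₑ ^ p) atTop (nhds (‖u x‖ₑ ^ p)) := by
    intro x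
    apply tendsto_const_nhds.congr'
    obtain ⟨m, hm⟩ := exists_nat_ge ‖x‖
    filter_upwards [eventually_ge_atTop m] with k hk
    have : χ k x = 1 := (hχ k).2.2.2.2.1 x (by
      have : (m : ℝ) ≤ k := by exact_mod_cast hk
      linarith)
    rw [this, one_mul]
  have hfin : ∫⁻ x, ‖u x‖ₑ ^ p ∂μ ≤ C * (ENNReal.ofReal ((1 + K) * N)) ^ p := by
    calc ∫⁻ x, ‖u x‖ₑ ^ p ∂μ = ∫⁻ x, liminf (fun k => ‖χ k x * u x‖ₑ ^ p) atTop ∂μ :=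
          lintegral_congr fun x => (hlim x).liminf_eq.symm
      _ ≤ liminf (fun k => ∫⁻ x, ‖χ k x * u x‖ₑ ^ p ∂μ) atTop :=
          lintegral_liminf_le fun k =>
            (((hχ k).1.continuous.mul hu.continuous).enorm.measurable).pow_const p
      _ ≤ _ := liminf_le_of_le (by isBoundedDefault) fun b hb => by
          obtain ⟨k, hk⟩ := hb.exists
          exact hk.trans (hstep k)
  have heq : ∀ x, ENNReal.ofReal (|u x| ^ p) = ‖u x‖ₑ ^ p := fun x => by
    rw [← ofReal_norm, ENNReal.ofReal_rpow_of_nonneg (norm_nonneg _) hp0.le, Real.norm_eq_abs]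
  have hval : (C : ENNReal) * (ENNReal.ofReal ((1 + K) * N)) ^ p =
      ENNReal.ofReal (C * (1 + K) ^ p * N ^ p) := by
    rw [ENNReal.ofReal_rpow_of_nonneg (by positivity) hp0.le, ← ENNReal.ofReal_coe_nnreal,
      ← ENNReal.ofReal_mul (by positivity), Real.mul_rpow (by positivity) hN0, mul_assoc]
  have hmeas : AEStronglyMeasurable (fun x => |u x| ^ p) μ :=
    ((hu.continuous.abs).rpow_const fun x => Or.inr hp0.le).aestronglyMeasurable
  have hnn : 0 ≤ᵐ[μ] fun x => |u x| ^ p := ae_of_all _ fun x => by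
    simp only [Pi.zero_apply]; positivity
  rw [hval] at hfin
  constructor
  · refine ⟨hmeas, ?_⟩
    rw [hasFiniteIntegral_iff_ofReal hnn]
    simp only [heq]
    exact hfin.trans_lt ENNReal.ofReal_lt_top
  · rw [integral_eq_lintegral_of_nonneg_ae hnn hmeas]
    simp only [heq]
    exact ENNReal.toReal_le_of_le_ofReal (by positivity) hfin

end Sobolev

section Dilation

variable {E : Type*} [NormedAddCommGroup E] [InnerProductSpace ℝ E] [FiniteDimensional ℝ E]
  [MeasurableSpace E] [BorelSpace E]

lemma integral_mul_fderiv_self_of_hasCompactSupport (μ : Measure E) [μ.IsAddHaarMeasure]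
    {u ψ : E → ℝ} (hu : ContDiff ℝ 1 u) (hψ : ContDiff ℝ 1 ψ) (hc : HasCompactSupport ψ) :
    ∫ x, ψ x * fderiv ℝ u x x ∂μ =
      -∫ x, (Module.finrank ℝ E * ψ x + fderiv ℝ ψ x x) * u x ∂μ := by
  let b := stdOrthonormalBasis ℝ E
  have hu' : Continuous (fderiv ℝ u) := hu.continuous_fderiv one_ne_zero
  have hψ' : Continuous (fderiv ℝ ψ) := hψ.continuous_fderiv one_ne_zero
  have hc' : HasCompactSupport (fderiv ℝ ψ) := hc.fderiv (𝕜 := ℝ)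
  have hx : ∀ x : E, ∀ L : E →L[ℝ] ℝ, L x = ∑ i, ⟪b i, x⟫ * L (b i) := by
    intro x L
    conv_lhs => rw [← b.sum_repr' x]
    simp
  have hder : ∀ i x, fderiv ℝ (fun x => ψ x * ⟪b i, x⟫) x (b i) =
      ψ x + ⟪b i, x⟫ * fderiv ℝ ψ x (b i) := by
    intro i x
    have h1 := ((hψ.differentiable one_ne_zero) x).hasFDerivAt
    have h2 : HasFDerivAt (fun x : E => ⟪b i, x⟫) (innerSL ℝ (b i)) x :=
      (innerSL ℝ (b i)).hasFDerivAt
    rw [show fderiv ℝ (fun x => ψ x * ⟪b i, x⟫) x = _ from (h1.mul h2).fderiv]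
    simp [b.orthonormal.1 i]
  have hcψ : ∀ i, HasCompactSupport (fun x => ψ x * ⟪b i, x⟫) := fun i => hc.mul_right
  have hI1 : ∀ i, Integrable (fun x => ψ x * ⟪b i, x⟫ * fderiv ℝ u x (b i)) μ := fun i =>
    Continuous.integrable_of_hasCompactSupport
      ((hψ.continuous.mul (by fun_prop)).mul (hu'.clm_apply continuous_const))
      (hcψ i).mul_right
  have hc2 : ∀ i, HasCompactSupport fun x => fderiv ℝ ψ x (b i) := fun i =>
    hc'.comp_left (g := fun L : E →L[ℝ] ℝ => L (b i)) rfl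
  have hI2 : ∀ i, Integrable (fun x => (ψ x + ⟪b i, x⟫ * fderiv ℝ ψ x (b i)) * u x) μ := fun i =>
    Continuous.integrable_of_hasCompactSupport
      ((hψ.continuous.add (Continuous.mul (by fun_prop)
        (hψ'.clm_apply continuous_const))).mul hu.continuous)
      (HasCompactSupport.mul_right (hc.add (hc2 i).mul_left))
  have hI3 : ∀ i, Integrable (fun x => ψ x * ⟪b i, x⟫ * u x) μ := fun i =>
    Continuous.integrable_of_hasCompactSupport
      ((hψ.continuous.mul (by fun_prop)).mul hu.continuous) (hcψ i).mul_right
  have hi : ∀ i, ∫ x, ψ x * ⟪b i, x⟫ * fderiv ℝ u x (b i) ∂μ =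
      -∫ x, (ψ x + ⟪b i, x⟫ * fderiv ℝ ψ x (b i)) * u x ∂μ := by
    intro i
    have h := integral_mul_fderiv_eq_neg_fderiv_mul_of_integrable (μ := μ) (v := b i)
      (f := fun x => ψ x * ⟪b i, x⟫) (g := u) (by simpa only [hder] using hI2 i) (hI1 i) (hI3 i)
      (fun x _ => ((hψ.differentiable one_ne_zero) x).mul
        (innerSL ℝ (b i)).differentiableAt)
      (fun x _ => (hu.differentiable one_ne_zero) x)
    simpa only [hder] using h
  calc ∫ x, ψ x * fderiv ℝ u x x ∂μ
      = ∫ x, ∑ i, ψ x * ⟪b i, x⟫ * fderiv ℝ u x (b i) ∂μ := by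
        refine integral_congr_ae (ae_of_all _ fun x => ?_)
        simp only
        rw [hx x (fderiv ℝ u x), Finset.mul_sum]
        simp only [mul_assoc]
    _ = ∑ i, -∫ x, (ψ x + ⟪b i, x⟫ * fderiv ℝ ψ x (b i)) * u x ∂μ := by
        rw [integral_finsetSum _ fun i _ => hI1 i]
        exact Finset.sum_congr rfl fun i _ => hi i
    _ = -∫ x, ∑ i, (ψ x + ⟪b i, x⟫ * fderiv ℝ ψ x (b i)) * u x ∂μ := by
        rw [integral_finsetSum _ fun i _ => hI2 i, Finset.sum_neg_distrib]
    _ = _ := by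
        congr 1
        refine integral_congr_ae (ae_of_all _ fun x => ?_)
        simp only
        rw [hx x (fderiv ℝ ψ x), ← Finset.sum_mul, Finset.sum_add_distrib]
        simp

/-- Integration by parts for the vector field `ψ(x) x` against a `W^{1,1}`-type function. -/
lemma integral_mul_fderiv_self (μ : Measure E) [μ.IsAddHaarMeasure]
    {u ψ : E → ℝ} (hu : ContDiff ℝ 1 u) (hψ : ContDiff ℝ 1 ψ) (hψ1 : ∀ x, |ψ x| ≤ 1)
    {L : ℝ} (hL : ∀ x, |fderiv ℝ ψ x x| ≤ L) (hiu : Integrable u μ)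
    (hiu' : Integrable (fun x => fderiv ℝ u x x) μ) :
    ∫ x, ψ x * fderiv ℝ u x x ∂μ =
      -∫ x, (Module.finrank ℝ E * ψ x + fderiv ℝ ψ x x) * u x ∂μ := by
  obtain ⟨K, hK0, hK⟩ := exists_cutoff E
  have hR : ∀ k : ℕ, (1 : ℝ) ≤ k + 1 := fun k => by have := Nat.cast_nonneg (α := ℝ) k; linarith
  choose χ hχ using fun k : ℕ => hK (k + 1) (hR k)
  have hL0 : 0 ≤ L := (abs_nonneg _).trans (hL 0)
  have hu' : Continuous (fderiv ℝ u) := hu.continuous_fderiv one_ne_zero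
  have hψ' : Continuous (fderiv ℝ ψ) := hψ.continuous_fderiv one_ne_zero
  have hder : ∀ k x, fderiv ℝ (fun x => ψ x * χ k x) x x =
      ψ x * fderiv ℝ (χ k) x x + χ k x * fderiv ℝ ψ x x := by
    intro k x
    rw [fderiv_fun_mul ((hψ.differentiable one_ne_zero) x)
      (((hχ k).1.differentiable one_ne_zero) x)]
    simp
  have hk : ∀ k, ∫ x, ψ x * χ k x * fderiv ℝ u x x ∂μ =
      -∫ x, (Module.finrank ℝ E * (ψ x * χ k x) +
        (ψ x * fderiv ℝ (χ k) x x + χ k x * fderiv ℝ ψ x x)) * u x ∂μ := by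
    intro k
    have := integral_mul_fderiv_self_of_hasCompactSupport μ hu (hψ.mul (hχ k).1)
      (hχ k).2.1.mul_left
    simpa only [hder] using this
  have hev : ∀ x : E, ∀ᶠ k : ℕ in atTop, χ k x = 1 ∧ fderiv ℝ (χ k) x = 0 := by
    intro x
    obtain ⟨m, hm⟩ := exists_nat_ge ‖x‖
    filter_upwards [eventually_ge_atTop m] with k hk
    have : (m : ℝ) ≤ k := by exact_mod_cast hk
    exact ⟨(hχ k).2.2.2.2.1 x (by linarith), (hχ k).2.2.2.2.2.2.2.2 x (by linarith)⟩
  have hχabs : ∀ k x, |χ k x| ≤ 1 := fun k x =>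
    abs_le.2 ⟨by linarith [(hχ k).2.2.1 x], (hχ k).2.2.2.1 x⟩
  have lim1 : Tendsto (fun k => ∫ x, ψ x * χ k x * fderiv ℝ u x x ∂μ) atTop
      (nhds (∫ x, ψ x * fderiv ℝ u x x ∂μ)) := by
    apply tendsto_integral_of_dominated_convergence (fun x => |fderiv ℝ u x x|)
    · intro k
      exact ((hψ.continuous.mul (hχ k).1.continuous).mul
        (hu'.clm_apply continuous_id)).aestronglyMeasurable
    · exact hiu'.abs
    · intro k
      refine ae_of_all _ fun x => ?_
      rw [norm_mul, Real.norm_eq_abs, Real.norm_eq_abs, abs_mul]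
      exact mul_le_of_le_one_left (abs_nonneg _)
        (mul_le_one₀ (hψ1 x) (abs_nonneg _) (hχabs k x))
    · refine ae_of_all _ fun x => ?_
      apply tendsto_const_nhds.congr'
      filter_upwards [hev x] with k hk
      rw [hk.1, mul_one]
  have lim2 : Tendsto (fun k => ∫ x, (Module.finrank ℝ E * (ψ x * χ k x) +
        (ψ x * fderiv ℝ (χ k) x x + χ k x * fderiv ℝ ψ x x)) * u x ∂μ) atTop
      (nhds (∫ x, (Module.finrank ℝ E * ψ x + fderiv ℝ ψ x x) * u x ∂μ)) := by
    apply tendsto_integral_of_dominated_convergence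
      (fun x => (Module.finrank ℝ E + (K + L)) * |u x|)
    · intro k
      exact (((continuous_const.mul (hψ.continuous.mul (hχ k).1.continuous)).add
        ((hψ.continuous.mul (((hχ k).1.continuous_fderiv one_ne_zero).clm_apply continuous_id)).add
        ((hχ k).1.continuous.mul (hψ'.clm_apply continuous_id)))).mul
        hu.continuous).aestronglyMeasurable
    · exact hiu.abs.const_mul _
    · intro k
      refine ae_of_all _ fun x => ?_
      rw [norm_mul, Real.norm_eq_abs, Real.norm_eq_abs]
      gcongr
      refine (abs_add_le _ _).trans (add_le_add ?_ ((abs_add_le _ _).trans (add_le_add ?_ ?_)))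
      · rw [abs_mul, abs_mul, Nat.abs_cast]
        exact mul_le_of_le_one_right (Nat.cast_nonneg _)
          (mul_le_one₀ (hψ1 x) (abs_nonneg _) (hχabs k x))
      · rw [abs_mul]
        exact (mul_le_of_le_one_left (abs_nonneg _) (hψ1 x)).trans ((hχ k).2.2.2.2.2.2.2.1 x)
      · rw [abs_mul]
        exact (mul_le_of_le_one_left (abs_nonneg _) (hχabs k x)).trans (hL x)
    · refine ae_of_all _ fun x => ?_
      apply tendsto_const_nhds.congr'
      filter_upwards [hev x] with k hk
      rw [hk.1, hk.2]
      simp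
  exact tendsto_nhds_unique lim1 ((lim2.neg).congr fun k => (hk k).symm)

end Dilation

section Poincare

lemma enorm_sub_le_lintegral_fderiv {E : Type*} [NormedAddCommGroup E] [NormedSpace ℝ E]
    {f : E → ℝ} (hf : ContDiff ℝ 1 f) (x y : E) :
    ‖f x - f y‖ₑ ≤
      ∫⁻ t in Set.Icc (0 : ℝ) 1, ‖fderiv ℝ f ((1 - t) • x + t • y)‖ₑ * ‖y - x‖ₑ := by
  have hf' : Continuous (fderiv ℝ f) := hf.continuous_fderiv one_ne_zero
  have hder : ∀ t : ℝ, HasDerivAt (fun t : ℝ => f ((1 - t) • x + t • y))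
      (fderiv ℝ f ((1 - t) • x + t • y) (y - x)) t := by
    intro t
    have h1 : HasDerivAt (fun t : ℝ => (1 - t) • x + t • y) (y - x) t := by
      have ha : HasDerivAt (fun t : ℝ => (1 - t) • x) ((-1 : ℝ) • x) t :=
        ((hasDerivAt_id t).const_sub 1).smul_const x
      have hb : HasDerivAt (fun t : ℝ => t • y) ((1 : ℝ) • y) t :=
        (hasDerivAt_id t).smul_const y
      exact (ha.add hb).congr_deriv (by simp; abel)
    exact ((hf.differentiable one_ne_zero) _).hasFDerivAt.comp_hasDerivAt t h1
  have hcont : Continuous fun t : ℝ => fderiv ℝ f ((1 - t) • x + t • y) (y - x) :=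
    (hf'.comp (by fun_prop)).clm_apply continuous_const
  have hftc := intervalIntegral.integral_eq_sub_of_hasDerivAt (a := 0) (b := 1)
    (fun t _ => hder t) (hcont.intervalIntegrable _ _)
  have : f x - f y = -∫ t in (0 : ℝ)..1, fderiv ℝ f ((1 - t) • x + t • y) (y - x) := by
    rw [hftc]; simp
  rw [this, enorm_neg, intervalIntegral.integral_of_le zero_le_one, ← integral_Icc_eq_integral_Ioc]
  refine (enorm_integral_le_lintegral_enorm _).trans (lintegral_mono fun t => ?_)
  exact (fderiv ℝ f ((1 - t) • x + t • y)).le_opENorm _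

variable {E : Type*} [NormedAddCommGroup E] [InnerProductSpace ℝ E] [FiniteDimensional ℝ E]
  [MeasurableSpace E] [BorelSpace E]

lemma setLIntegral_comp_convexCombination_le (μ : Measure E) [μ.IsAddHaarMeasure] {B : Set E}
    (hB : Convex ℝ B) (hBm : MeasurableSet B) {x : E} (hx : x ∈ B) {t : ℝ} (ht : 1 / 2 ≤ t)
    (ht1 : t ≤ 1) {h : E → ENNReal} (hh : Measurable h) :
    ∫⁻ y in B, h ((1 - t) • x + t • y) ∂μ ≤
      2 ^ Module.finrank ℝ E * ∫⁻ y in B, h y ∂μ := by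
  have ht0 : 0 < t := by linarith
  have hm : Measurable (B.indicator h) := hh.indicator hBm
  calc ∫⁻ y in B, h ((1 - t) • x + t • y) ∂μ
      = ∫⁻ y in B, B.indicator h ((1 - t) • x + t • y) ∂μ := by
        refine setLIntegral_congr_fun hBm fun y hy => ?_
        exact (Set.indicator_of_mem (hB hx hy (by linarith) ht0.le (by ring)) h).symm
    _ ≤ ∫⁻ y, B.indicator h ((1 - t) • x + t • y) ∂μ := setLIntegral_le_lintegral _ _
    _ = ∫⁻ y, B.indicator h ((1 - t) • x + y) ∂(Measure.map (t • ·) μ) := by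
        exact (lintegral_map (f := fun y => B.indicator h ((1 - t) • x + y))
          (hm.comp (measurable_const_add _)) (measurable_const_smul t)).symm
    _ = ENNReal.ofReal |(t ^ Module.finrank ℝ E)⁻¹| * ∫⁻ y in B, h y ∂μ := by
        rw [Measure.map_addHaar_smul μ ht0.ne', lintegral_smul_measure,
          lintegral_add_left_eq_self, lintegral_indicator hBm, smul_eq_mul]
    _ ≤ _ := by
        gcongr
        rw [← ENNReal.ofReal_ofNat 2, ← ENNReal.ofReal_pow (by norm_num)]
        apply ENNReal.ofReal_le_ofReal
        rw [abs_of_pos (by positivity), ← inv_pow]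
        have : t⁻¹ ≤ 2 := by
          rw [inv_le_comm₀ ht0 (by norm_num)]; linarith
        gcongr

/-- The `L¹` Poincaré inequality on a ball. -/
lemma lintegral_lintegral_enorm_sub_le (μ : Measure E) [μ.IsAddHaarMeasure] (R : ℝ) :
    ∃ C : NNReal, ∀ f : E → ℝ, ContDiff ℝ 1 f →
      ∫⁻ x in Metric.closedBall (0 : E) R, ∫⁻ y in Metric.closedBall (0 : E) R,
        ‖f x - f y‖ₑ ∂μ ∂μ ≤ C * ∫⁻ x in Metric.closedBall (0 : E) R, ‖fderiv ℝ f x‖ₑ ∂μ := by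
  set B := Metric.closedBall (0 : E) R with hBdef
  have hB : Convex ℝ B := convex_closedBall _ _
  have hBm : MeasurableSet B := Metric.isClosed_closedBall.measurableSet
  have hBfin : μ B ≠ ⊤ := (isCompact_closedBall (0 : E) R).measure_lt_top.ne
  let C : ENNReal := ENNReal.ofReal (2 * R) * (2 ^ Module.finrank ℝ E * μ B)
  have hC : C ≠ ⊤ := ENNReal.mul_ne_top ENNReal.ofReal_ne_top
    (ENNReal.mul_ne_top (ENNReal.pow_ne_top (by simp)) hBfin)
  refine ⟨C.toNNReal, fun f hf => ?_⟩
  rw [ENNReal.coe_toNNReal hC]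
  have hf' : Continuous (fderiv ℝ f) := hf.continuous_fderiv one_ne_zero
  set h : E → ENNReal := fun x => ‖fderiv ℝ f x‖ₑ with hdef
  have hh : Continuous h := hf'.enorm
  have hh3 : Continuous fun z : (E × E) × ℝ => h ((1 - z.2) • z.1.1 + z.2 • z.1.2) :=
    hh.comp (by fun_prop)
  have hfix : ∀ t ∈ Set.Icc (0 : ℝ) 1,
      ∫⁻ x in B, ∫⁻ y in B, h ((1 - t) • x + t • y) ∂μ ∂μ ≤
        2 ^ Module.finrank ℝ E * μ B * ∫⁻ y in B, h y ∂μ := by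
    intro t ht
    have hconst : ∫⁻ _ in B, 2 ^ Module.finrank ℝ E * ∫⁻ y in B, h y ∂μ ∂μ =
        2 ^ Module.finrank ℝ E * μ B * ∫⁻ y in B, h y ∂μ := by
      rw [setLIntegral_const]; ring
    rw [← hconst]
    rcases le_total (1 / 2) t with h2 | h2
    · exact setLIntegral_mono' hBm fun x hx =>
        setLIntegral_comp_convexCombination_le μ hB hBm hx h2 ht.2 hh.measurable
    · rw [lintegral_lintegral_swap]
      · refine setLIntegral_mono' hBm fun y hy => ?_
        have := setLIntegral_comp_convexCombination_le μ hB hBm hy (t := 1 - t) (by linarith)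
          (by linarith [ht.1]) hh.measurable
        simpa only [sub_sub_cancel, add_comm] using this
      · exact (hh.comp (by fun_prop : Continuous fun z : E × E =>
          (1 - t) • z.1 + t • z.2)).measurable.aemeasurable
  calc ∫⁻ x in B, ∫⁻ y in B, ‖f x - f y‖ₑ ∂μ ∂μ
      ≤ ∫⁻ x in B, ∫⁻ y in B, ENNReal.ofReal (2 * R) *
          (∫⁻ t in Set.Icc (0 : ℝ) 1, h ((1 - t) • x + t • y)) ∂μ ∂μ := by
        refine setLIntegral_mono' hBm fun x hx => setLIntegral_mono' hBm fun y hy => ?_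
        refine (enorm_sub_le_lintegral_fderiv hf x y).trans ?_
        rw [lintegral_mul_const _ (by
          exact (hh.comp (by fun_prop : Continuous fun t : ℝ => (1 - t) • x + t • y)).measurable),
          mul_comm]
        gcongr
        rw [← ofReal_norm]
        apply ENNReal.ofReal_le_ofReal
        have h1 : ‖x‖ ≤ R := by simpa [hBdef] using hx
        have h2 : ‖y‖ ≤ R := by simpa [hBdef] using hy
        linarith [norm_sub_le y x]
    _ = ENNReal.ofReal (2 * R) * ∫⁻ t in Set.Icc (0 : ℝ) 1,
          ∫⁻ x in B, ∫⁻ y in B, h ((1 - t) • x + t • y) ∂μ ∂μ := by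
        simp_rw [lintegral_const_mul' _ _ ENNReal.ofReal_ne_top]
        congr 1
        rw [lintegral_lintegral_swap (f := fun (t : ℝ) (x : E) => ∫⁻ y in B,
          h ((1 - t) • x + t • y) ∂μ)]
        · refine lintegral_congr fun x => ?_
          rw [lintegral_lintegral_swap]
          exact (hh.comp (by fun_prop : Continuous fun z : E × ℝ =>
            (1 - z.2) • x + z.2 • z.1)).measurable.aemeasurable
        · apply Measurable.aemeasurable
          exact Measurable.lintegral_prod_right'
            (f := fun z : (ℝ × E) × E => h ((1 - z.1.1) • z.1.2 + z.1.1 • z.2))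
            (hh.comp (by fun_prop)).measurable
    _ ≤ ENNReal.ofReal (2 * R) * ∫⁻ t in Set.Icc (0 : ℝ) 1,
          2 ^ Module.finrank ℝ E * μ B * ∫⁻ y in B, h y ∂μ := by
        exact mul_le_mul_right (setLIntegral_mono' measurableSet_Icc hfix) _
    _ = _ := by
        rw [setLIntegral_const]
        simp only [Real.volume_Icc, sub_zero, ENNReal.ofReal_one, mul_one, C]
        ring

end Poincare

section Potential

/-- Even convex `C¹` potentials with superlinear growth and `x · ∇Φ(x) ≤ (A + 1) Φ(x)`. -/
structure IsPotential {n : ℕ} (Φ : EuclideanSpace ℝ (Fin n) → ℝ) (A : ℝ) : Prop where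
  contDiff : ContDiff ℝ 1 Φ
  convexOn : ConvexOn ℝ Set.univ Φ
  even : ∀ x, Φ (-x) = Φ x
  nonneg : ∀ x, 0 ≤ Φ x
  map_zero : Φ 0 = 0
  coercive : Tendsto (fun x => Φ x / ‖x‖) (cobounded (EuclideanSpace ℝ (Fin n))) atTop
  growth : ∀ x, ⟪x, gradient Φ x⟫ ≤ (A + 1) * Φ x
  integrable : Integrable (fun x => Real.exp (-Φ x))

namespace IsPotential

variable {n : ℕ} {Φ : EuclideanSpace ℝ (Fin n) → ℝ} {A : ℝ}

lemma exists_mul_norm_le (h : IsPotential Φ A) (M : ℝ) :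
    ∃ R : ℝ, 0 < R ∧ ∀ z, R ≤ ‖z‖ → M * ‖z‖ ≤ Φ z := by
  obtain ⟨R, -, hR⟩ := (hasBasis_cobounded_norm.eventually_iff).1
    (h.coercive.eventually_ge_atTop M)
  refine ⟨max R 1, by positivity, fun z hz => ?_⟩
  have h1 := hR (show z ∈ {x | R ≤ ‖x‖} from (le_max_left _ _).trans hz)
  have h2 : 0 < ‖z‖ := lt_of_lt_of_le one_pos ((le_max_right _ _).trans hz)
  rwa [le_div_iff₀ h2] at h1

lemma bddAbove (h : IsPotential Φ A) (y : EuclideanSpace ℝ (Fin n)) :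
    BddAbove (Set.range fun z => ⟪y, z⟫ - Φ z) := by
  obtain ⟨R, hR0, hR⟩ := h.exists_mul_norm_le ‖y‖
  refine ⟨‖y‖ * R, ?_⟩
  rintro _ ⟨z, rfl⟩
  have h1 := real_inner_le_norm y z
  rcases le_total R ‖z‖ with h2 | h2
  · have := hR z h2
    have : 0 ≤ ‖y‖ * R := by positivity
    simp only; linarith
  · have := h.nonneg z
    have : ‖y‖ * ‖z‖ ≤ ‖y‖ * R := by gcongr
    simp only; linarith

lemma inner_le (h : IsPotential Φ A) (y z : EuclideanSpace ℝ (Fin n)) :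
    ⟪y, z⟫ ≤ legendre Φ y + Φ z := by
  have := le_ciSup (h.bddAbove y) z
  unfold legendre
  linarith

lemma abs_inner_le (h : IsPotential Φ A) (y z : EuclideanSpace ℝ (Fin n)) :
    |⟪y, z⟫| ≤ legendre Φ y + Φ z := by
  rw [abs_le']
  refine ⟨h.inner_le y z, ?_⟩
  have := h.inner_le y (-z)
  rwa [inner_neg_right, h.even] at this

lemma legendre_nonneg (h : IsPotential Φ A) (y : EuclideanSpace ℝ (Fin n)) :
    0 ≤ legendre Φ y := by
  have := h.inner_le y 0
  simpa [h.map_zero] using this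

lemma add_inner_gradient_le (h : IsPotential Φ A) (x z : EuclideanSpace ℝ (Fin n)) :
    Φ x + ⟪gradient Φ x, z - x⟫ ≤ Φ z := by
  have hc : ConvexOn ℝ Set.univ (fun t : ℝ => Φ (AffineMap.lineMap x z t)) :=
    h.convexOn.comp_affineMap (AffineMap.lineMap x z)
  have hd : HasDerivAt (fun t : ℝ => Φ (AffineMap.lineMap x z t)) (fderiv ℝ Φ x (z - x)) 0 := by
    have h1 : HasDerivAt (fun t : ℝ => AffineMap.lineMap x z t) (z - x) 0 :=
      AffineMap.hasDerivAt_lineMap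
    have h2 : HasFDerivAt Φ (fderiv ℝ Φ x) (AffineMap.lineMap x z (0 : ℝ)) := by
      rw [AffineMap.lineMap_apply_zero]
      exact ((h.contDiff.differentiable one_ne_zero) x).hasFDerivAt
    exact h2.comp_hasDerivAt 0 h1
  have := hc.le_slope_of_hasDerivAt (Set.mem_univ 0) (Set.mem_univ 1) one_pos hd
  rw [slope_def_field] at this
  simp only [AffineMap.lineMap_apply_zero, AffineMap.lineMap_apply_one, sub_zero, div_one] at this
  rw [inner_gradient_left]
  linarith

lemma le_inner_gradient (h : IsPotential Φ A) (x : EuclideanSpace ℝ (Fin n)) :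
    Φ x ≤ ⟪x, gradient Φ x⟫ := by
  have := h.add_inner_gradient_le x 0
  rw [zero_sub, inner_neg_right, h.map_zero, real_inner_comm] at this
  linarith

lemma inner_gradient_sub_le (h : IsPotential Φ A) (x z : EuclideanSpace ℝ (Fin n)) :
    ⟪gradient Φ x, z⟫ ≤ A * Φ x + Φ z := by
  have h1 := h.add_inner_gradient_le x z
  have h2 := h.growth x
  rw [inner_sub_right, real_inner_comm x] at h1
  linarith

/-- Both `∇Φ` and the identity are controlled by the entropic quantities. -/
lemma exists_norm_le (h : IsPotential Φ A) :
    ∃ M : ℝ, 0 ≤ M ∧ (∀ x, ‖gradient Φ x‖ ≤ A * Φ x + M) ∧ ∀ y, ‖y‖ ≤ legendre Φ y + M := by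
  obtain ⟨M, hM⟩ := (isCompact_closedBall (0 : EuclideanSpace ℝ (Fin n)) 1).exists_bound_of_continuousOn
    h.contDiff.continuous.continuousOn
  have hu : ∀ y : EuclideanSpace ℝ (Fin n), Φ (‖y‖⁻¹ • y) ≤ M ∧ ⟪y, ‖y‖⁻¹ • y⟫ = ‖y‖ := by
    intro y
    constructor
    · refine (le_abs_self _).trans (hM _ ?_)
      rw [mem_closedBall_zero_iff, norm_smul, norm_inv, norm_norm]
      exact inv_mul_le_one
    · rw [inner_smul_right, real_inner_self_eq_norm_sq]
      by_cases hy : ‖y‖ = 0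
      · simp [hy]
      · field_simp
  refine ⟨M, (norm_nonneg _).trans (hM 0 (by simp)), fun x => ?_, fun y => ?_⟩
  · have h1 := h.inner_gradient_sub_le x (‖gradient Φ x‖⁻¹ • gradient Φ x)
    have h2 := hu (gradient Φ x)
    linarith [h2.1, h2.2]
  · have h1 := h.inner_le y (‖y‖⁻¹ • y)
    have h2 := hu y
    linarith [h2.1, h2.2]

lemma integrable_exp_neg_half (h : IsPotential Φ A) :
    Integrable fun x => Real.exp (-(Φ x / 2)) := by
  have h1 : Integrable fun x => Real.exp (-Φ ((1 / 2 : ℝ) • x)) :=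
    h.integrable.comp_smul (by norm_num)
  refine h1.mono' (h.contDiff.continuous.div_const 2).neg.rexp.aestronglyMeasurable
    (ae_of_all _ fun x => ?_)
  rw [Real.norm_of_nonneg (Real.exp_pos _).le, Real.exp_le_exp]
  have hhalf : (0 : ℝ) ≤ 1 / 2 := by norm_num
  have := h.convexOn.2 (Set.mem_univ x) (Set.mem_univ 0) hhalf hhalf (by norm_num)
  simp only [smul_zero, add_zero, h.map_zero, smul_eq_mul] at this
  linarith

end IsPotential

end Potential

section Admissible

variable {n : ℕ} {Φ : EuclideanSpace ℝ (Fin n) → ℝ} {A c₀ C₂ : ℝ}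
  {g : EuclideanSpace ℝ (Fin n) → ℝ}

/-- The Lebesgue density of `e^g μ_Φ`, with `Z_Φ = exp c₀`. -/
noncomputable def gibbsDensity (Φ : EuclideanSpace ℝ (Fin n) → ℝ) (c₀ : ℝ)
    (g : EuclideanSpace ℝ (Fin n) → ℝ) (x : EuclideanSpace ℝ (Fin n)) : ℝ :=
  Real.exp (g x - Φ x - c₀)

/-- The energy `∫ Φ*(C₂ ∇g) e^g dμ_Φ`. -/
noncomputable def gibbsEnergy (Φ : EuclideanSpace ℝ (Fin n) → ℝ) (c₀ C₂ : ℝ)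
    (g : EuclideanSpace ℝ (Fin n) → ℝ) : ℝ :=
  ∫ x, legendre Φ (C₂ • gradient g x) * gibbsDensity Φ c₀ g x

/-- `C¹` functions `g` for which `e^g μ_Φ` is a probability measure with finite entropy and
finite energy. -/
structure IsAdmissible (Φ : EuclideanSpace ℝ (Fin n) → ℝ) (c₀ C₂ : ℝ)
    (g : EuclideanSpace ℝ (Fin n) → ℝ) : Prop where
  contDiff : ContDiff ℝ 1 g
  integrable : Integrable (gibbsDensity Φ c₀ g)
  integral_eq_one : ∫ x, gibbsDensity Φ c₀ g x = 1
  integrable_mul : Integrable fun x => g x * gibbsDensity Φ c₀ g x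
  integrable_legendre :
    Integrable fun x => legendre Φ (C₂ • gradient g x) * gibbsDensity Φ c₀ g x

lemma gibbsDensity_pos (x : EuclideanSpace ℝ (Fin n)) : 0 < gibbsDensity Φ c₀ g x :=
  Real.exp_pos _

lemma continuous_gradient_of_contDiff {f : EuclideanSpace ℝ (Fin n) → ℝ} (hf : ContDiff ℝ 1 f) :
    Continuous (gradient f) :=
  (InnerProductSpace.toDual ℝ _).symm.continuous.comp (hf.continuous_fderiv one_ne_zero)

lemma fderiv_apply_eq_inner_gradient (f : EuclideanSpace ℝ (Fin n) → ℝ)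
    (x y : EuclideanSpace ℝ (Fin n)) : fderiv ℝ f x y = ⟪gradient f x, y⟫ := by
  simp [gradient]

lemma norm_fderiv_eq_norm_gradient (f : EuclideanSpace ℝ (Fin n) → ℝ)
    (x : EuclideanSpace ℝ (Fin n)) : ‖fderiv ℝ f x‖ = ‖gradient f x‖ := by
  simp [gradient]

lemma gibbsEnergy_nonneg (h : IsPotential Φ A) : 0 ≤ gibbsEnergy Φ c₀ C₂ g :=
  integral_nonneg fun _ => mul_nonneg (h.legendre_nonneg _) (gibbsDensity_pos _).le

namespace IsAdmissible

lemma contDiff_gibbsDensity (hg : IsAdmissible Φ c₀ C₂ g) (h : IsPotential Φ A) :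
    ContDiff ℝ 1 (gibbsDensity Φ c₀ g) :=
  ((hg.contDiff.sub h.contDiff).sub contDiff_const).exp

lemma fderiv_gibbsDensity (hg : IsAdmissible Φ c₀ C₂ g) (h : IsPotential Φ A)
    (x : EuclideanSpace ℝ (Fin n)) :
    fderiv ℝ (gibbsDensity Φ c₀ g) x =
      gibbsDensity Φ c₀ g x • (fderiv ℝ g x - fderiv ℝ Φ x) := by
  have h1 := (hg.contDiff.differentiable one_ne_zero x).hasFDerivAt
  have h2 := (h.contDiff.differentiable one_ne_zero x).hasFDerivAt
  exact (((h1.sub h2).sub_const c₀).exp).fderiv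

lemma integrable_potential_mul (hg : IsAdmissible Φ c₀ C₂ g) (h : IsPotential Φ A) :
    Integrable fun x => Φ x * gibbsDensity Φ c₀ g x := by
  refine ((hg.integrable_mul.const_mul 2).add
    (h.integrable_exp_neg_half.const_mul (2 * Real.exp (-c₀)))).mono'
    (h.contDiff.continuous.mul (hg.contDiff_gibbsDensity h).continuous).aestronglyMeasurable
    (Eventually.of_forall fun x => ?_)
  have h1 := Real.add_one_le_exp (Φ x / 2 - g x)
  have h2 : Real.exp (Φ x / 2 - g x) * gibbsDensity Φ c₀ g x =
      Real.exp (-c₀) * Real.exp (-(Φ x / 2)) := by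
    rw [gibbsDensity, ← Real.exp_add, ← Real.exp_add]; ring_nf
  have h3 := gibbsDensity_pos (Φ := Φ) (c₀ := c₀) (g := g) x
  rw [Real.norm_of_nonneg (mul_nonneg (h.nonneg x) h3.le)]
  have h4 : (Φ x / 2 - g x) * gibbsDensity Φ c₀ g x ≤
      Real.exp (Φ x / 2 - g x) * gibbsDensity Φ c₀ g x := by gcongr; linarith
  simp only [Pi.add_apply]
  rw [h2] at h4
  nlinarith

lemma integrable_norm_gradient_mul (hg : IsAdmissible Φ c₀ C₂ g) (h : IsPotential Φ A)
    (hC : 0 < C₂) {M : ℝ} (hM : ∀ y, ‖y‖ ≤ legendre Φ y + M) :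
    Integrable (fun x => ‖gradient g x‖ * gibbsDensity Φ c₀ g x) ∧
      ∫ x, ‖gradient g x‖ * gibbsDensity Φ c₀ g x ≤ (gibbsEnergy Φ c₀ C₂ g + M) / C₂ := by
  have hb : ∀ x, ‖gradient g x‖ * gibbsDensity Φ c₀ g x ≤
      (legendre Φ (C₂ • gradient g x) * gibbsDensity Φ c₀ g x + M * gibbsDensity Φ c₀ g x) /
        C₂ := by
    intro x
    have h1 := hM (C₂ • gradient g x)
    rw [norm_smul, Real.norm_of_nonneg hC.le] at h1
    rw [le_div_iff₀ hC, ← add_mul]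
    have h3 := gibbsDensity_pos (Φ := Φ) (c₀ := c₀) (g := g) x
    calc _ = (C₂ * ‖gradient g x‖) * gibbsDensity Φ c₀ g x := by ring
      _ ≤ _ := by gcongr
  have hi := (hg.integrable_legendre.add (hg.integrable.const_mul M)).div_const C₂
  have hInt : Integrable (fun x => ‖gradient g x‖ * gibbsDensity Φ c₀ g x) := by
    refine hi.mono' ((continuous_gradient_of_contDiff hg.contDiff).norm.mul
      (hg.contDiff_gibbsDensity h).continuous).aestronglyMeasurable
      (Eventually.of_forall fun x => ?_)
    rw [Real.norm_of_nonneg (mul_nonneg (norm_nonneg _) (gibbsDensity_pos x).le)]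
    exact hb x
  refine ⟨hInt, (integral_mono hInt hi hb).trans_eq ?_⟩
  simp only [Pi.add_apply]
  rw [integral_div, integral_add hg.integrable_legendre (hg.integrable.const_mul M),
    integral_const_mul, hg.integral_eq_one, mul_one, gibbsEnergy]

lemma integrable_inner_gradient_mul (hg : IsAdmissible Φ c₀ C₂ g) (h : IsPotential Φ A)
    (hC : 1 ≤ C₂) :
    Integrable fun x => ⟪gradient g x, x⟫ * gibbsDensity Φ c₀ g x := by
  refine (hg.integrable_legendre.add (hg.integrable_potential_mul h)).mono'
    (((continuous_gradient_of_contDiff hg.contDiff).inner continuous_id).mul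
      (hg.contDiff_gibbsDensity h).continuous).aestronglyMeasurable
      (Eventually.of_forall fun x => ?_)
  have h1 := h.abs_inner_le (C₂ • gradient g x) x
  rw [real_inner_smul_left, abs_mul, abs_of_nonneg (by linarith : 0 ≤ C₂)] at h1
  have h2 : |⟪gradient g x, x⟫| ≤ C₂ * |⟪gradient g x, x⟫| :=
    le_mul_of_one_le_left (abs_nonneg _) hC
  have h3 := gibbsDensity_pos (Φ := Φ) (c₀ := c₀) (g := g) x
  rw [norm_mul, Real.norm_of_nonneg h3.le, Real.norm_eq_abs, Pi.add_apply, ← add_mul]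
  gcongr
  exact h2.trans h1

lemma integrable_inner_gradient_potential_mul (hg : IsAdmissible Φ c₀ C₂ g)
    (h : IsPotential Φ A) :
    Integrable fun x => ⟪gradient Φ x, x⟫ * gibbsDensity Φ c₀ g x := by
  refine ((hg.integrable_potential_mul h).const_mul (A + 1)).mono'
    (((continuous_gradient_of_contDiff h.contDiff).inner continuous_id).mul
      (hg.contDiff_gibbsDensity h).continuous).aestronglyMeasurable
      (Eventually.of_forall fun x => ?_)
  have h1 := h.growth x
  have h2 := (h.nonneg x).trans (h.le_inner_gradient x)
  rw [real_inner_comm] at h1 h2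
  have h3 := gibbsDensity_pos (Φ := Φ) (c₀ := c₀) (g := g) x
  rw [Real.norm_of_nonneg (mul_nonneg h2 h3.le), ← mul_assoc]
  gcongr

lemma fderiv_gibbsDensity_self (hg : IsAdmissible Φ c₀ C₂ g) (h : IsPotential Φ A)
    (x : EuclideanSpace ℝ (Fin n)) :
    fderiv ℝ (gibbsDensity Φ c₀ g) x x = ⟪gradient g x, x⟫ * gibbsDensity Φ c₀ g x -
      ⟪gradient Φ x, x⟫ * gibbsDensity Φ c₀ g x := by
  rw [hg.fderiv_gibbsDensity h, ← fderiv_apply_eq_inner_gradient,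
    ← fderiv_apply_eq_inner_gradient]
  simp
  ring

lemma integral_mul_potential_le (hg : IsAdmissible Φ c₀ C₂ g) (h : IsPotential Φ A)
    (hC : 2 ≤ C₂) {ψ : EuclideanSpace ℝ (Fin n) → ℝ} (hψ : ContDiff ℝ 1 ψ)
    (hψ0 : ∀ x, 0 ≤ ψ x) (hψ1 : ∀ x, ψ x ≤ 1) {L : ℝ} (hL : ∀ x, |fderiv ℝ ψ x x| ≤ L) :
    ∫ x, ψ x * (Φ x * gibbsDensity Φ c₀ g x) ≤ gibbsEnergy Φ c₀ C₂ g +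
      2 * ∫ x, (n * ψ x + fderiv ℝ ψ x x) * gibbsDensity Φ c₀ g x := by
  set ρ := gibbsDensity Φ c₀ g with hρ
  have hρ0 : ∀ x, 0 < ρ x := gibbsDensity_pos
  have hψa : ∀ x, |ψ x| ≤ 1 := fun x => by rw [abs_of_nonneg (hψ0 x)]; exact hψ1 x
  have hψn : ∀ᵐ x, ‖ψ x‖ ≤ 1 := Eventually.of_forall hψa
  have hψm := hψ.continuous.aestronglyMeasurable (μ := volume)
  have hi1 := hg.integrable_inner_gradient_mul h (by linarith)
  have hi2 := hg.integrable_inner_gradient_potential_mul h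
  have hi3 := hg.integrable_potential_mul h
  have hself : (fun x => fderiv ℝ ρ x x) = fun x => ⟪gradient g x, x⟫ * ρ x -
      ⟪gradient Φ x, x⟫ * ρ x := funext (hg.fderiv_gibbsDensity_self h)
  have key := integral_mul_fderiv_self volume (hg.contDiff_gibbsDensity h) hψ hψa hL
    hg.integrable (by rw [hself]; exact hi1.sub hi2)
  have j1 := hi1.bdd_mul hψm hψn
  have j2 := hi2.bdd_mul hψm hψn
  have j3 := hi3.bdd_mul hψm hψn
  have e1 : ∫ x, ψ x * fderiv ℝ ρ x x = (∫ x, ψ x * (⟪gradient g x, x⟫ * ρ x)) -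
      ∫ x, ψ x * (⟪gradient Φ x, x⟫ * ρ x) := by
    rw [← integral_sub j1 j2]
    refine integral_congr_ae (Eventually.of_forall fun x => ?_)
    simp only [congrFun hself x]; ring
  have e2 : ∫ x, ψ x * (Φ x * ρ x) ≤ ∫ x, ψ x * (⟪gradient Φ x, x⟫ * ρ x) := by
    refine integral_mono j3 j2 fun x => ?_
    have := h.le_inner_gradient x
    rw [real_inner_comm] at this
    have := hρ0 x
    have := hψ0 x
    simp only
    gcongr
  have e3 : ∫ x, ψ x * (⟪gradient g x, x⟫ * ρ x) ≤
      (gibbsEnergy Φ c₀ C₂ g + ∫ x, ψ x * (Φ x * ρ x)) / 2 := by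
    rw [gibbsEnergy, ← integral_add hg.integrable_legendre j3, ← integral_div]
    refine integral_mono j1 ((hg.integrable_legendre.add j3).div_const 2) fun x => ?_
    have h1 := h.abs_inner_le (C₂ • gradient g x) x
    rw [real_inner_smul_left, abs_mul, abs_of_nonneg (by linarith : 0 ≤ C₂)] at h1
    have h2 : 2 * |⟪gradient g x, x⟫| ≤ C₂ * |⟪gradient g x, x⟫| := by gcongr
    have h3 : 2 * ⟪gradient g x, x⟫ ≤ legendre Φ (C₂ • gradient g x) + Φ x := by
      linarith [le_abs_self ⟪gradient g x, x⟫]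
    have h4 : 2 * (ψ x * ⟪gradient g x, x⟫) ≤
        legendre Φ (C₂ • gradient g x) + ψ x * Φ x := by
      have := mul_le_mul_of_nonneg_left h3 (hψ0 x)
      have := mul_le_of_le_one_left (h.legendre_nonneg (C₂ • gradient g x)) (hψ1 x)
      linarith
    have := mul_le_mul_of_nonneg_right h4 (hρ0 x).le
    simp only [← hρ]
    linarith
  simp only [finrank_euclideanSpace, Fintype.card_fin] at key
  rw [e1] at key
  linarith

lemma integral_potential_le (hg : IsAdmissible Φ c₀ C₂ g) (h : IsPotential Φ A) (hC : 2 ≤ C₂) :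
    ∫ x, Φ x * gibbsDensity Φ c₀ g x ≤ gibbsEnergy Φ c₀ C₂ g + 2 * n := by
  have := hg.integral_mul_potential_le h hC (ψ := fun _ => 1) contDiff_const (by simp) (by simp)
    (L := 0) (by simp)
  simpa [integral_const_mul, hg.integral_eq_one] using this

lemma norm_mul_setIntegral_le (hg : IsAdmissible Φ c₀ C₂ g) (h : IsPotential Φ A) (hC : 2 ≤ C₂)
    {R : ℝ} (hR : ∀ z, R ≤ ‖z‖ → ‖z‖ ≤ Φ z) :
    R * ∫ x in {x | R ≤ ‖x‖}, gibbsDensity Φ c₀ g x ≤ gibbsEnergy Φ c₀ C₂ g + 2 * n := by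
  have hS : MeasurableSet {x : EuclideanSpace ℝ (Fin n) | R ≤ ‖x‖} :=
    measurableSet_le measurable_const measurable_norm
  have hi := hg.integrable_potential_mul h
  rw [← integral_const_mul]
  calc _ ≤ ∫ x in {x | R ≤ ‖x‖}, Φ x * gibbsDensity Φ c₀ g x := by
        refine setIntegral_mono_on (hg.integrable.const_mul R).integrableOn hi.integrableOn hS
          fun x hx => ?_
        have := (gibbsDensity_pos (Φ := Φ) (c₀ := c₀) (g := g) x).le
        have := le_trans hx (hR x hx)
        gcongr
    _ ≤ ∫ x, Φ x * gibbsDensity Φ c₀ g x :=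
        setIntegral_le_integral hi (Eventually.of_forall fun x =>
          mul_nonneg (h.nonneg x) (gibbsDensity_pos x).le)
    _ ≤ _ := hg.integral_potential_le h hC

end IsAdmissible

lemma IsPotential.exists_setIntegral_potential_le (h : IsPotential Φ A) :
    ∃ K : ℝ, 0 ≤ K ∧ ∃ R₀ : ℝ, 1 ≤ R₀ ∧ ∀ R, R₀ ≤ R → ∀ (c₀ C₂ : ℝ)
      (g : EuclideanSpace ℝ (Fin n) → ℝ), 2 ≤ C₂ → IsAdmissible Φ c₀ C₂ g →
      ∫ x in {x | R < ‖x‖}, gibbsDensity Φ c₀ g x ≤ K * (gibbsEnergy Φ c₀ C₂ g + 2 * n) / R ∧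
      ∫ x in {x | R < ‖x‖}, Φ x * gibbsDensity Φ c₀ g x ≤
        gibbsEnergy Φ c₀ C₂ g + K * (gibbsEnergy Φ c₀ C₂ g + 2 * n) / R := by
  obtain ⟨K, hK, hχ⟩ := exists_cutoff (EuclideanSpace ℝ (Fin n))
  obtain ⟨R₁, hR₁, hΦ⟩ := h.exists_mul_norm_le 1
  refine ⟨4 * (n + K) + 2, by positivity, 2 * max R₁ 1, by linarith [le_max_right R₁ 1],
    fun R hR c₀ C₂ g hC hg => ?_⟩
  obtain ⟨r, rfl⟩ : ∃ r, R = 2 * r := ⟨R / 2, by ring⟩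
  have hr1 : 1 ≤ r := by linarith [le_max_right R₁ 1]
  have hr2 : R₁ ≤ r := by linarith [le_max_left R₁ 1]
  set ρ := gibbsDensity Φ c₀ g with hρ
  set J := gibbsEnergy Φ c₀ C₂ g with hJ
  have hρ0 : ∀ x, 0 < ρ x := gibbsDensity_pos
  have hJ0 : 0 ≤ J := gibbsEnergy_nonneg h
  have hS : MeasurableSet {x : EuclideanSpace ℝ (Fin n) | r ≤ ‖x‖} :=
    measurableSet_le measurable_const measurable_norm
  have hT : MeasurableSet {x : EuclideanSpace ℝ (Fin n) | 2 * r < ‖x‖} :=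
    measurableSet_lt measurable_const measurable_norm
  have hmass := hg.norm_mul_setIntegral_le h hC (R := r) fun z hz => by
    simpa using hΦ z (hr2.trans hz)
  rw [← hρ, ← hJ] at hmass
  have hmass' : ∫ x in {x | r ≤ ‖x‖}, ρ x ≤ (J + 2 * n) / r := by
    rw [le_div_iff₀ (by linarith)]; linarith
  have hi := hg.integrable_potential_mul h
  constructor
  · calc ∫ x in {x | 2 * r < ‖x‖}, ρ x ≤ ∫ x in {x | r ≤ ‖x‖}, ρ x := by
          refine setIntegral_mono_set hg.integrable.integrableOn
            (Eventually.of_forall fun x => (hρ0 x).le) (LE.le.eventuallyLE ?_)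
          exact fun x (hx : 2 * r < ‖x‖) => show r ≤ ‖x‖ by linarith
      _ ≤ _ := hmass'
      _ = 2 * (J + 2 * n) / (2 * r) := by field_simp
      _ ≤ _ := by
          gcongr
          have : (0:ℝ) ≤ 4 * (n + K) := by positivity
          linarith
  · obtain ⟨χ, hχd, -, hχ0, hχ1, hχin, hχout, -, hχL, hχz⟩ := hχ r hr1
    have hd : ∀ x, fderiv ℝ (fun y => 1 - χ y) x = -fderiv ℝ χ x := fun x => by
      rw [fderiv_const_sub]
    have key := hg.integral_mul_potential_le h hC (ψ := fun x => 1 - χ x)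
      (contDiff_const.sub hχd) (fun x => by linarith [hχ1 x]) (fun x => by linarith [hχ0 x])
      (L := K) (fun x => by simpa [hd] using hχL x)
    rw [← hρ, ← hJ] at key
    have h1 : ∫ x in {x | 2 * r < ‖x‖}, Φ x * ρ x ≤ ∫ x, (1 - χ x) * (Φ x * ρ x) := by
      rw [← integral_indicator hT]
      refine integral_mono (hi.indicator hT) (hi.bdd_mul (c := 1)
        (continuous_const.sub hχd.continuous).aestronglyMeasurable
        (Eventually.of_forall fun x => ?_)) fun x => ?_
      · rw [Real.norm_eq_abs, abs_le]; constructor <;> linarith [hχ0 x, hχ1 x]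
      · have hp := mul_nonneg (h.nonneg x) (hρ0 x).le
        by_cases hx : 2 * r < ‖x‖
        · rw [Set.indicator_of_mem (by exact hx), hχout x hx.le]; simp [hρ]
        · rw [Set.indicator_of_notMem (by exact hx)]
          exact mul_nonneg (by linarith [hχ1 x]) hp
    have h2 : ∫ x, (n * (1 - χ x) + fderiv ℝ (fun y => 1 - χ y) x x) * ρ x ≤
        (n + K) * ∫ x in {x | r ≤ ‖x‖}, ρ x := by
      rw [← integral_const_mul, ← integral_indicator hS]
      have hle : ∀ x, |n * (1 - χ x) + fderiv ℝ (fun y => 1 - χ y) x x| ≤ n + K := fun x => by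
        have e1 : |(n : ℝ) * (1 - χ x)| ≤ n := by
          rw [abs_of_nonneg (mul_nonneg n.cast_nonneg (by linarith [hχ1 x]))]
          exact mul_le_of_le_one_right n.cast_nonneg (by linarith [hχ0 x])
        have e2 : |fderiv ℝ (fun y => 1 - χ y) x x| ≤ K := by simpa [hd] using hχL x
        exact (abs_add_le _ _).trans (add_le_add e1 e2)
      refine integral_mono (hg.integrable.bdd_mul (c := n + K) ?_ (Eventually.of_forall hle))
        ((hg.integrable.const_mul (n + K)).indicator hS) fun x => ?_
      · exact ((continuous_const.mul (continuous_const.sub hχd.continuous)).add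
          (((contDiff_const.sub hχd).continuous_fderiv one_ne_zero).clm_apply
            continuous_id)).aestronglyMeasurable
      · by_cases hx : r ≤ ‖x‖
        · rw [Set.indicator_of_mem (by exact hx)]
          have := (hρ0 x).le
          have := (abs_le.1 (hle x)).2
          simp only
          gcongr
        · rw [Set.indicator_of_notMem (by exact hx)]
          simp [hd, hχin x (not_le.1 hx).le, hχz x (not_le.1 hx)]
    calc _ ≤ _ := h1
      _ ≤ _ := key
      _ ≤ J + 2 * ((n + K) * ((J + 2 * n) / r)) := by
          gcongr
          exact h2.trans (by gcongr)
      _ = J + 4 * (n + K) * (J + 2 * n) / (2 * r) := by field_simp; ring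
      _ ≤ _ := by
          gcongr
          linarith

lemma IsPotential.exists_integral_rpow_le (h : IsPotential Φ A) (hA : 0 ≤ A) :
    ∃ p : ℝ, 1 < p ∧ ∃ C a b : ℝ, 0 ≤ C ∧ 1 ≤ a ∧ 0 ≤ b ∧ ∀ (c₀ C₂ : ℝ)
      (g : EuclideanSpace ℝ (Fin n) → ℝ), 2 ≤ C₂ → IsAdmissible Φ c₀ C₂ g →
      Integrable (fun x => gibbsDensity Φ c₀ g x ^ p) ∧
      ∫ x, gibbsDensity Φ c₀ g x ^ p ≤ C * (a + b * gibbsEnergy Φ c₀ C₂ g) ^ p := by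
  obtain ⟨p, hp, C, hC, hsob⟩ :=
    sobolev_of_integrable (volume : Measure (EuclideanSpace ℝ (Fin n)))
  obtain ⟨M, hM, hM1, hM2⟩ := h.exists_norm_le
  refine ⟨p, hp, C, 1 + 2 * M + A * (2 * n), 1 + A, hC, ?_, by positivity,
    fun c₀ C₂ g hC₂ hg => ?_⟩
  · have : 0 ≤ 2 * M + A * (2 * n) := by positivity
    linarith
  set ρ := gibbsDensity Φ c₀ g with hρ
  set J := gibbsEnergy Φ c₀ C₂ g with hJ
  have hρ0 : ∀ x, 0 < ρ x := gibbsDensity_pos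
  have hJ0 : 0 ≤ J := gibbsEnergy_nonneg h
  obtain ⟨hi1, hb1⟩ := hg.integrable_norm_gradient_mul h (by linarith) hM2
  have hi2 := hg.integrable_potential_mul h
  have hρd := hg.contDiff_gibbsDensity h
  have hi3 := (hi1.add (hi2.const_mul A)).add (hg.integrable.const_mul M)
  have hle : ∀ x, ‖fderiv ℝ ρ x‖ ≤ ‖gradient g x‖ * ρ x + A * (Φ x * ρ x) + M * ρ x := by
    intro x
    rw [hρ, hg.fderiv_gibbsDensity h, norm_smul, Real.norm_of_nonneg (gibbsDensity_pos x).le]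
    have h1 := norm_sub_le (fderiv ℝ g x) (fderiv ℝ Φ x)
    rw [norm_fderiv_eq_norm_gradient g, norm_fderiv_eq_norm_gradient Φ] at h1
    have h2 := mul_le_mul_of_nonneg_left (h1.trans (add_le_add_right (hM1 x) _)) (hρ0 x).le
    rw [← hρ]
    linarith
  have hi4 : Integrable (fderiv ℝ ρ) :=
    hi3.mono' (hρd.continuous_fderiv one_ne_zero).aestronglyMeasurable (Eventually.of_forall hle)
  obtain ⟨hInt, hbd⟩ := hsob ρ hρd hg.integrable hi4
  simp only [abs_of_pos (hρ0 _)] at hInt hbd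
  rw [hg.integral_eq_one] at hbd
  refine ⟨hInt, hbd.trans ?_⟩
  have h5 : ∫ x, ‖fderiv ℝ ρ x‖ ≤ (J + M) / C₂ + A * (J + 2 * n) + M := by
    refine (integral_mono hi4.norm hi3 hle).trans ?_
    have e : ∫ x, (‖gradient g x‖ * ρ x + A * (Φ x * ρ x) + M * ρ x) =
        (∫ x, ‖gradient g x‖ * ρ x) + A * (∫ x, Φ x * ρ x) + M := by
      have hi12 : Integrable fun x => ‖gradient g x‖ * ρ x + A * (Φ x * ρ x) :=
        hi1.add (hi2.const_mul A)
      rw [integral_add hi12 (hg.integrable.const_mul M), integral_add hi1 (hi2.const_mul A), integral_const_mul, integral_const_mul,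
        hg.integral_eq_one, mul_one]
    refine e.trans_le ?_
    have := mul_le_mul_of_nonneg_left (hg.integral_potential_le h hC₂) hA
    linarith
  have h6 : (J + M) / C₂ ≤ J + M := div_le_self (by positivity) (by linarith)
  have h7 : 0 ≤ ∫ x, ‖fderiv ℝ ρ x‖ := integral_nonneg fun _ => norm_nonneg _
  have h8 : 0 ≤ 1 + ∫ x, ‖fderiv ℝ ρ x‖ := by linarith
  have h9 : 1 + ∫ x, ‖fderiv ℝ ρ x‖ ≤ 1 + 2 * M + A * (2 * n) + (1 + A) * J := by linarith
  exact mul_le_mul_of_nonneg_left (Real.rpow_le_rpow h8 h9 (by linarith)) hC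

lemma IsAdmissible.setIntegral_mul_le (hg : IsAdmissible Φ c₀ C₂ g) (h : IsPotential Φ A) {p : ℝ}
    (hp : 1 < p) (hInt : Integrable fun x => gibbsDensity Φ c₀ g x ^ p) (l : ℝ)
    (S : Set (EuclideanSpace ℝ (Fin n))) :
    ∫ x in S, g x * gibbsDensity Φ c₀ g x ≤
      (l + c₀) * (∫ x in S, gibbsDensity Φ c₀ g x) +
      Real.exp (-((p - 1) * l)) / (p - 1) * (∫ x, gibbsDensity Φ c₀ g x ^ p) +
      ∫ x in S, Φ x * gibbsDensity Φ c₀ g x := by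
  set ρ := gibbsDensity Φ c₀ g with hρ
  have hρ0 : ∀ x, 0 < ρ x := gibbsDensity_pos
  have hp' : 0 < p - 1 := by linarith
  set q := Real.exp (-((p - 1) * l)) / (p - 1) with hq
  have hq0 : 0 ≤ q := by positivity
  have hi1 := (hg.integrable.const_mul (l + c₀)).integrableOn (s := S)
  have hi2 := (hInt.const_mul q).integrableOn (s := S)
  have hi3 := (hg.integrable_potential_mul h).integrableOn (s := S)
  have h1 : ∀ x, g x * ρ x ≤ (l + c₀) * ρ x + q * ρ x ^ p + Φ x * ρ x := by
    intro x
    have hlog : Real.log (ρ x) = g x - Φ x - c₀ := Real.log_exp _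
    have h2 := Real.add_one_le_exp ((p - 1) * (Real.log (ρ x) - l))
    have h3 : Real.exp ((p - 1) * (Real.log (ρ x) - l)) =
        Real.exp (-((p - 1) * l)) * ρ x ^ (p - 1) := by
      rw [Real.rpow_def_of_pos (hρ0 x), ← Real.exp_add]; ring_nf
    have h4 : Real.log (ρ x) - l ≤ q * ρ x ^ (p - 1) := by
      rw [hq, div_mul_eq_mul_div, le_div_iff₀ hp', ← h3]; linarith
    have h5 : ρ x ^ p = ρ x ^ (p - 1) * ρ x := by
      rw [← Real.rpow_add_one (hρ0 x).ne']; ring_nf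
    rw [hlog] at h4
    rw [h5]
    have := mul_le_mul_of_nonneg_right h4 (hρ0 x).le
    linarith
  calc _ ≤ ∫ x in S, ((l + c₀) * ρ x + q * ρ x ^ p + Φ x * ρ x) :=
        integral_mono hg.integrable_mul.integrableOn ((hi1.add hi2).add hi3) h1
    _ = (l + c₀) * (∫ x in S, ρ x) + q * (∫ x in S, ρ x ^ p) + ∫ x in S, Φ x * ρ x := by
        have hi12 : IntegrableOn (fun x => (l + c₀) * ρ x + q * ρ x ^ p) S := hi1.add hi2
        rw [integral_add hi12 hi3, integral_add hi1 hi2, integral_const_mul,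
          integral_const_mul]
    _ ≤ _ := by
        have : ∫ x in S, ρ x ^ p ≤ ∫ x, ρ x ^ p :=
          setIntegral_le_integral hInt (Eventually.of_forall fun x =>
            (Real.rpow_pos_of_pos (hρ0 x) _).le)
        gcongr

lemma IsPotential.exists_integral_mul_le (h : IsPotential Φ A) (hA : 0 ≤ A) (c₀ : ℝ) :
    ∃ D D' : ℝ, 0 ≤ D ∧ 0 ≤ D' ∧ ∀ (C₂ : ℝ)
      (g : EuclideanSpace ℝ (Fin n) → ℝ), 2 ≤ C₂ → IsAdmissible Φ c₀ C₂ g →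
      ∫ x, g x * gibbsDensity Φ c₀ g x ≤ D + D' * gibbsEnergy Φ c₀ C₂ g := by
  obtain ⟨p, hp, C, a, b, hC, ha, hb, hsob⟩ := h.exists_integral_rpow_le hA
  have hp' : 0 < p - 1 := by linarith
  refine ⟨p / (p - 1) * a + |c₀| + C / (p - 1) + 2 * n, p / (p - 1) * b + 1, by positivity,
    by positivity, fun C₂ g hC₂ hg => ?_⟩
  obtain ⟨hInt, hbd⟩ := hsob c₀ C₂ g hC₂ hg
  set J := gibbsEnergy Φ c₀ C₂ g with hJ
  have hJ0 : 0 ≤ J := gibbsEnergy_nonneg h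
  set N := a + b * J with hN
  have hN1 : 0 < N := by positivity
  have key := hg.setIntegral_mul_le h hp hInt (p / (p - 1) * Real.log N) Set.univ
  simp only [setIntegral_univ, hg.integral_eq_one] at key
  have e1 : Real.exp (-((p - 1) * (p / (p - 1) * Real.log N))) = (N ^ p)⁻¹ := by
    rw [Real.rpow_def_of_pos hN1, ← Real.exp_neg]
    congr 1; field_simp
  rw [e1] at key
  have e2 : (N ^ p)⁻¹ / (p - 1) * (∫ x, gibbsDensity Φ c₀ g x ^ p) ≤ C / (p - 1) := by
    have hNp := Real.rpow_pos_of_pos hN1 p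
    calc _ ≤ (N ^ p)⁻¹ / (p - 1) * (C * N ^ p) := by gcongr
      _ = _ := by field_simp
  have e3 : p / (p - 1) * Real.log N ≤ p / (p - 1) * N := by
    gcongr
    linarith [Real.log_le_sub_one_of_pos hN1]
  have e4 := hg.integral_potential_le h hC₂
  have e5 := le_abs_self c₀
  rw [hN] at e3
  linarith

lemma IsPotential.exists_setIntegral_gibbsDensity_le (h : IsPotential Φ A) (c₀ R : ℝ)
    (hR : 5 / 6 ≤ ∫ x in Metric.closedBall 0 R, Real.exp (-Φ x - c₀)) :
    ∃ K : ℝ, 0 ≤ K ∧ ∀ (C₂ : ℝ) (g : EuclideanSpace ℝ (Fin n) → ℝ), IsAdmissible Φ c₀ C₂ g →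
      Integrable (fun x => ‖gradient g x‖ * gibbsDensity Φ c₀ g x) →
      ∫ x in Metric.closedBall 0 R ∩ {x | Real.log (3 / 2) < g x}, gibbsDensity Φ c₀ g x ≤
        K * ∫ x, ‖gradient g x‖ * gibbsDensity Φ c₀ g x := by
  obtain ⟨C, hC⟩ :=
    lintegral_lintegral_enorm_sub_le (volume : Measure (EuclideanSpace ℝ (Fin n))) R
  obtain ⟨P, hP⟩ := (isCompact_closedBall (0 : EuclideanSpace ℝ (Fin n)) R).bddAbove_image
    h.contDiff.continuous.continuousOn
  set B := Metric.closedBall (0 : EuclideanSpace ℝ (Fin n)) R with hB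
  have hBm : MeasurableSet B := Metric.isClosed_closedBall.measurableSet
  set W := Real.exp (-c₀) with hW
  have hW0 : 0 < W := Real.exp_pos _
  refine ⟨6 * W * W * (C * Real.exp (c₀ + P)), by positivity, fun C₂ g hg hgi => ?_⟩
  set ρ := gibbsDensity Φ c₀ g with hρ
  have hρ0 : ∀ x, 0 < ρ x := gibbsDensity_pos
  set f : EuclideanSpace ℝ (Fin n) → ℝ := fun x => Real.exp (g x) with hf
  have hfd : ContDiff ℝ 1 f := hg.contDiff.exp
  set w : EuclideanSpace ℝ (Fin n) → ℝ := fun x => Real.exp (-Φ x - c₀) with hw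
  have hwc : Continuous w := (h.contDiff.continuous.neg.sub continuous_const).rexp
  have hρfw : ∀ x, ρ x = f x * w x := fun x => by
    simp only [hρ, gibbsDensity, hf, hw, ← Real.exp_add]; ring_nf
  have hwW : ∀ x, w x ≤ W := fun x => Real.exp_le_exp.2 (by linarith [h.nonneg x])
  have hw0 : ∀ x, 0 < w x := fun x => Real.exp_pos _
  have hf0 : ∀ x, 0 < f x := fun x => Real.exp_pos _
  have hcomp : IsCompact B := isCompact_closedBall _ _
  have hpt : ∀ x, Real.log (3 / 2) < g x → f x ≤ 6 * W * ∫ y in B, |f x - f y| := by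
    intro x hx
    have hfx : 3 / 2 ≤ f x := by
      have := Real.exp_le_exp.2 hx.le
      rwa [Real.exp_log (by norm_num)] at this
    have i1 : IntegrableOn (fun y => f x * w y) B :=
      (continuous_const.mul hwc).continuousOn.integrableOn_compact hcomp
    have i2 : IntegrableOn ρ B := hg.integrable.integrableOn
    have i3 : IntegrableOn (fun y => |f x - f y|) B :=
      (continuous_const.sub hfd.continuous).abs.continuousOn.integrableOn_compact hcomp
    have h1 : ∫ y in B, ρ y ≤ 1 := hg.integral_eq_one ▸
      setIntegral_le_integral hg.integrable (Eventually.of_forall fun x => (hρ0 x).le)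
    have h2 : (∫ y in B, f x * w y) - ∫ y in B, ρ y ≤ W * ∫ y in B, |f x - f y| := by
      rw [← integral_sub i1 i2, ← integral_const_mul]
      refine integral_mono (i1.sub i2) (i3.const_mul W) fun y => ?_
      simp only [hρfw, ← sub_mul]
      calc (f x - f y) * w y ≤ |f x - f y| * w y := by
            have := (hw0 y).le
            gcongr
            exact le_abs_self _
        _ ≤ |f x - f y| * W := by gcongr; exact hwW y
        _ = _ := mul_comm _ _
    rw [integral_const_mul] at h2
    have h3 := mul_le_mul_of_nonneg_left hR (hf0 x).le
    linarith
  have hT : MeasurableSet (B ∩ {x | Real.log (3 / 2) < g x}) :=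
    hBm.inter (measurableSet_lt measurable_const hg.contDiff.continuous.measurable)
  have hfin : 0 ≤ ∫ x, ‖gradient g x‖ * ρ x :=
    integral_nonneg fun x => mul_nonneg (norm_nonneg _) (hρ0 x).le
  rw [← ENNReal.ofReal_le_ofReal_iff (by positivity),
    ofReal_integral_eq_lintegral_ofReal hg.integrable.integrableOn
      (Eventually.of_forall fun x => (hρ0 x).le)]
  calc ∫⁻ x in B ∩ {x | Real.log (3 / 2) < g x}, ENNReal.ofReal (ρ x)
      ≤ ∫⁻ x in B ∩ {x | Real.log (3 / 2) < g x},
          ENNReal.ofReal (6 * W * W) * ∫⁻ y in B, ‖f x - f y‖ₑ := by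
        refine setLIntegral_mono' hT fun x hx => ?_
        have i3 : IntegrableOn (fun y => f x - f y) B :=
          (continuous_const.sub hfd.continuous).continuousOn.integrableOn_compact hcomp
        rw [← ofReal_integral_norm_eq_lintegral_enorm i3,
          ← ENNReal.ofReal_mul (by positivity)]
        refine ENNReal.ofReal_le_ofReal ?_
        rw [hρfw]
        have h0 := hpt x hx.2
        have h1 : 0 ≤ 6 * W * ∫ y in B, |f x - f y| := (hf0 x).le.trans h0
        calc f x * w x ≤ (6 * W * ∫ y in B, |f x - f y|) * W :=
              mul_le_mul h0 (hwW x) (hw0 x).le h1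
          _ = _ := by simp only [Real.norm_eq_abs]; ring
    _ ≤ ∫⁻ x in B, ENNReal.ofReal (6 * W * W) * ∫⁻ y in B, ‖f x - f y‖ₑ :=
        lintegral_mono_set Set.inter_subset_left
    _ = ENNReal.ofReal (6 * W * W) * ∫⁻ x in B, ∫⁻ y in B, ‖f x - f y‖ₑ :=
        lintegral_const_mul' _ _ ENNReal.ofReal_ne_top
    _ ≤ ENNReal.ofReal (6 * W * W) * (C * ∫⁻ x in B, ‖fderiv ℝ f x‖ₑ) := by
        gcongr
        exact hC f hfd
    _ ≤ ENNReal.ofReal (6 * W * W) * (C * ∫⁻ x in B,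
          ENNReal.ofReal (Real.exp (c₀ + P)) * ENNReal.ofReal (‖gradient g x‖ * ρ x)) := by
        gcongr 2
        refine setLIntegral_mono' hBm fun x hx => ?_
        rw [← ENNReal.ofReal_mul (Real.exp_pos _).le, ← ofReal_norm]
        refine ENNReal.ofReal_le_ofReal ?_
        have e1 : fderiv ℝ f x = f x • fderiv ℝ g x :=
          ((hg.contDiff.differentiable one_ne_zero x).hasFDerivAt.exp).fderiv
        rw [e1, norm_smul, Real.norm_of_nonneg (hf0 x).le, norm_fderiv_eq_norm_gradient]
        have e2 : f x = Real.exp (c₀ + Φ x) * ρ x := by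
          simp only [hρ, gibbsDensity, hf, ← Real.exp_add]; ring_nf
        have e3 : Real.exp (c₀ + Φ x) ≤ Real.exp (c₀ + P) := by
          have := hP ⟨x, hx, rfl⟩
          gcongr
        rw [e2]
        have := (hρ0 x).le
        calc _ ≤ Real.exp (c₀ + P) * ρ x * ‖gradient g x‖ := by gcongr
          _ = _ := by ring
    _ = ENNReal.ofReal (6 * W * W) * (C * (ENNReal.ofReal (Real.exp (c₀ + P)) *
          ∫⁻ x in B, ENNReal.ofReal (‖gradient g x‖ * ρ x))) := by
        rw [lintegral_const_mul' _ _ ENNReal.ofReal_ne_top]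
    _ ≤ ENNReal.ofReal (6 * W * W) * (C * (ENNReal.ofReal (Real.exp (c₀ + P)) *
          ∫⁻ x, ENNReal.ofReal (‖gradient g x‖ * ρ x))) := by
        gcongr
        exact Measure.restrict_le_self
    _ = _ := by
        rw [← ofReal_integral_eq_lintegral_ofReal hgi
          (Eventually.of_forall fun x => mul_nonneg (norm_nonneg _) (hρ0 x).le),
          ← ENNReal.ofReal_coe_nnreal (p := C), ← ENNReal.ofReal_mul (Real.exp_pos _).le,
          ← ENNReal.ofReal_mul C.coe_nonneg, ← ENNReal.ofReal_mul (by positivity)]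
        congr 1; ring

lemma IsPotential.exists_integral_mul_lt_one (h : IsPotential Φ A) (hA : 0 ≤ A) (c₀ : ℝ)
    (hc₀ : ∫ x, Real.exp (-Φ x - c₀) = 1) :
    ∃ C₂ c : ℝ, 2 ≤ C₂ ∧ 0 < c ∧ ∀ g : EuclideanSpace ℝ (Fin n) → ℝ, IsAdmissible Φ c₀ C₂ g →
      gibbsEnergy Φ c₀ C₂ g ≤ c → ∫ x, g x * gibbsDensity Φ c₀ g x < 1 := by
  obtain ⟨p, hp, C, a, b, hC, ha, hb, hsob⟩ := h.exists_integral_rpow_le hA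
  obtain ⟨K, hK, R₀, hR₀, htail⟩ := h.exists_setIntegral_potential_le
  obtain ⟨M, hM, -, hM2⟩ := h.exists_norm_le
  have hp' : 0 < p - 1 := by linarith
  obtain ⟨l, hl1, hl2⟩ : ∃ l, |c₀| ≤ l ∧
      Real.exp (-((p - 1) * l)) / (p - 1) * (C * (a + b) ^ p) ≤ 1 / 16 := by
    have ht : Tendsto (fun l => Real.exp (-((p - 1) * l)) / (p - 1) * (C * (a + b) ^ p))
        atTop (nhds (0 / (p - 1) * (C * (a + b) ^ p))) :=
      ((Real.tendsto_exp_neg_atTop_nhds_zero.comp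
        (tendsto_id.const_mul_atTop hp')).div_const _).mul_const _
    rw [zero_div, zero_mul] at ht
    have := (eventually_ge_atTop |c₀|).and (ht.eventually_le_const (by norm_num : (0:ℝ) < 1 / 16))
    exact this.exists
  obtain ⟨L, hL⟩ : ∃ L, L = l + c₀ := ⟨_, rfl⟩
  have hL0 : 0 ≤ L := by linarith [neg_abs_le c₀]
  obtain ⟨R, hRR, hR2, hR3⟩ : ∃ R, R₀ ≤ R ∧ (L + 1) * (K * (1 + 2 * n) / R) ≤ 1 / 16 ∧
      5 / 6 ≤ ∫ x in Metric.closedBall 0 R, Real.exp (-Φ x - c₀) := by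
    have hi : Integrable fun x => Real.exp (-Φ x - c₀) := by
      by_contra hcon
      rw [integral_undef hcon] at hc₀
      exact zero_ne_one hc₀
    have t1 : Tendsto (fun R : ℝ => (L + 1) * (K * (1 + 2 * n) / R)) atTop
        (nhds ((L + 1) * 0)) := (tendsto_const_nhds.div_atTop tendsto_id).const_mul _
    rw [mul_zero] at t1
    have t2 := (aecover_closedBall (μ := (volume : Measure (EuclideanSpace ℝ (Fin n))))
      (x := 0) (r := fun R : ℝ => R) tendsto_id).integral_tendsto_of_countably_generated hi
    rw [hc₀] at t2
    have := (eventually_ge_atTop R₀).and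
      ((t1.eventually_le_const (by norm_num : (0:ℝ) < 1 / 16)).and
        (t2.eventually_const_le (by norm_num : (5:ℝ) / 6 < 1)))
    exact this.exists
  have hRpos : 0 < R := by linarith
  obtain ⟨P, hP⟩ := (isCompact_closedBall (0 : EuclideanSpace ℝ (Fin n)) R).bddAbove_image
    h.contDiff.continuous.continuousOn
  have hP0 : 0 ≤ P := (h.nonneg 0).trans (hP ⟨0, by simp [hRpos.le], rfl⟩)
  obtain ⟨K', hK', hmass⟩ := h.exists_setIntegral_gibbsDensity_le c₀ R hR3
  obtain ⟨C₂, hC₂⟩ : ∃ C₂, C₂ = max 2 (16 * ((L + P) * (K' * (1 + M)))) := ⟨_, rfl⟩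
  have hC₂' : 2 ≤ C₂ := hC₂ ▸ le_max_left _ _
  have hC₂'' : 16 * ((L + P) * (K' * (1 + M))) ≤ C₂ := hC₂ ▸ le_max_right _ _
  refine ⟨C₂, 1 / 16, hC₂', by norm_num, fun g hg hJc => ?_⟩
  obtain ⟨hInt, hbd⟩ := hsob c₀ C₂ g hC₂' hg
  obtain ⟨ht1, ht2⟩ := htail R hRR c₀ C₂ g hC₂' hg
  obtain ⟨hgi, hgb⟩ := hg.integrable_norm_gradient_mul h (by linarith) hM2
  have hm := hmass C₂ g hg hgi
  set ρ := gibbsDensity Φ c₀ g with hρ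
  set J := gibbsEnergy Φ c₀ C₂ g with hJ
  have hJ0 : 0 ≤ J := gibbsEnergy_nonneg h
  have hρ0 : ∀ x, 0 < ρ x := gibbsDensity_pos
  set T := Metric.closedBall (0 : EuclideanSpace ℝ (Fin n)) R ∩ {x | Real.log (3 / 2) < g x}
    with hT
  set U := {x : EuclideanSpace ℝ (Fin n) | R < ‖x‖} with hU
  have hTm : MeasurableSet T := Metric.isClosed_closedBall.measurableSet.inter
    (measurableSet_lt measurable_const hg.contDiff.continuous.measurable)
  have hUm : MeasurableSet U := measurableSet_lt measurable_const measurable_norm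
  have hdisj : Disjoint T U := Set.disjoint_left.2 fun x hx (hx' : R < ‖x‖) => by
    have := mem_closedBall_zero_iff.1 hx.1
    linarith
  have hΦi := hg.integrable_potential_mul h
  have key := hg.setIntegral_mul_le h hp hInt l (T ∪ U)
  rw [setIntegral_union hdisj hUm hg.integrable.integrableOn hg.integrable.integrableOn,
    setIntegral_union hdisj hUm hΦi.integrableOn hΦi.integrableOn, ← hρ, ← hL] at key
  have h1 : ∫ x in T, Φ x * ρ x ≤ P * ∫ x in T, ρ x := by
    rw [← integral_const_mul]
    refine setIntegral_mono_on hΦi.integrableOn (hg.integrable.const_mul P).integrableOn hTm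
      fun x hx => ?_
    have := hP ⟨x, hx.1, rfl⟩
    have := (hρ0 x).le
    gcongr
  have h2 : ∫ x in (T ∪ U)ᶜ, g x * ρ x ≤ 1 / 2 := by
    calc _ ≤ ∫ x in (T ∪ U)ᶜ, 1 / 2 * ρ x := by
          refine setIntegral_mono_on hg.integrable_mul.integrableOn
            (hg.integrable.const_mul _).integrableOn (hTm.union hUm).compl fun x hx => ?_
          have hxB : ‖x‖ ≤ R := not_lt.1 fun hx' => hx (Or.inr hx')
          have hxg : g x ≤ Real.log (3 / 2) := not_lt.1 fun hx' =>
            hx (Or.inl ⟨mem_closedBall_zero_iff.2 hxB, hx'⟩)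
          have := Real.log_le_sub_one_of_pos (by norm_num : (0:ℝ) < 3 / 2)
          have := (hρ0 x).le
          gcongr
          linarith
      _ ≤ ∫ x, 1 / 2 * ρ x := setIntegral_le_integral (hg.integrable.const_mul _)
          (Eventually.of_forall fun x => mul_nonneg (by norm_num) (hρ0 x).le)
      _ = 1 / 2 := by rw [integral_const_mul, hg.integral_eq_one, mul_one]
  have h3 : Real.exp (-((p - 1) * l)) / (p - 1) * ∫ x, ρ x ^ p ≤ 1 / 16 := by
    refine (mul_le_mul_of_nonneg_left (hbd.trans ?_) (by positivity)).trans hl2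
    gcongr
    exact mul_le_of_le_one_right hb (by linarith)
  have h4 : K * (J + 2 * n) / R ≤ K * (1 + 2 * n) / R := by
    gcongr
    linarith
  have h5 : (L + P) * ∫ x in T, ρ x ≤ 1 / 16 := by
    have e1 : ∫ x in T, ρ x ≤ K' * ((1 + M) / C₂) := hm.trans (by
      gcongr
      refine hgb.trans ?_
      gcongr
      linarith)
    have e2 := mul_le_mul_of_nonneg_left e1 (by linarith : 0 ≤ L + P)
    refine e2.trans ?_
    rw [show (L + P) * (K' * ((1 + M) / C₂)) = (L + P) * (K' * (1 + M)) / C₂ by ring,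
      div_le_iff₀ (by linarith)]
    linarith
  have h6 := mul_le_mul_of_nonneg_left (ht1.trans h4) hL0
  rw [← integral_add_compl (hTm.union hUm) hg.integrable_mul]
  linarith

end Admissible

theorem log_sobolev_large_entropy (n : ℕ) (Φ : EuclideanSpace ℝ (Fin n) → ℝ)
    (hΦ : ContDiff ℝ 1 Φ) (hconv : StrictConvexOn ℝ Set.univ Φ)
    (heven : ∀ x, Φ (-x) = Φ x) (hnonneg : ∀ x, 0 ≤ Φ x) (h0 : Φ 0 = 0)
    (hcoer : Tendsto (fun x => Φ x / ‖x‖) (cobounded (EuclideanSpace ℝ (Fin n))) atTop)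
    (hcond : Tendsto (fun α : ℝ =>
        ⨆ x, (1 - α) * legendre Φ ((1 - α)⁻¹ • x) / legendre Φ x)
      (nhdsWithin 0 (Set.Ioi 0)) (nhds 1))
    (A : ℝ) (hA : 0 < A)
    (hgrowth : ∀ x, ⟪x, gradient Φ x⟫ ≤ (A + 1) * Φ x)
    (hZ : Integrable (fun x => Real.exp (-Φ x)))
    (μ : Measure (EuclideanSpace ℝ (Fin n)))
    (hμ : μ = volume.withDensity fun x =>
      ENNReal.ofReal (Real.exp (-Φ x) / ∫ y, Real.exp (-Φ y))) :
    ∃ C₁ C₂ : ℝ, 0 ≤ C₁ ∧ 0 ≤ C₂ ∧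
      ∀ g : EuclideanSpace ℝ (Fin n) → ℝ, ContDiff ℝ 1 g →
        Integrable (fun x => Real.exp (g x)) μ →
        (∫ x, Real.exp (g x) ∂μ) = 1 →
        Integrable (fun x =>
          Real.exp (g x) * Real.log (Real.exp (g x) / ∫ y, Real.exp (g y) ∂μ)) μ →
        Integrable (fun x => legendre Φ (C₂ • gradient g x) * Real.exp (g x)) μ →
        1 ≤ Ent μ (fun x => Real.exp (g x)) →
        Ent μ (fun x => Real.exp (g x)) ≤
          C₁ * ∫ x, legendre Φ (C₂ • gradient g x) * Real.exp (g x) ∂μ := by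
  have h : IsPotential Φ A := ⟨hΦ, hconv.convexOn, heven, hnonneg, h0, hcoer, hgrowth, hZ⟩
  have hZpos : 0 < ∫ y, Real.exp (-Φ y) := integral_exp_pos hZ
  set c₀ := Real.log (∫ y, Real.exp (-Φ y)) with hc₀
  have hw : ∀ x, Real.exp (-Φ x) / ∫ y, Real.exp (-Φ y) = Real.exp (-Φ x - c₀) := fun x => by
    rw [Real.exp_sub, hc₀, Real.exp_log hZpos]
  have hmass : ∫ x, Real.exp (-Φ x - c₀) = 1 := by
    simp only [← hw]
    rw [integral_div, div_self hZpos.ne']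
  simp only [hw] at hμ
  have hm : Measurable fun x => ENNReal.ofReal (Real.exp (-Φ x - c₀)) :=
    (hΦ.continuous.neg.sub continuous_const).rexp.measurable.ennreal_ofReal
  have htop : ∀ᵐ x : EuclideanSpace ℝ (Fin n), ENNReal.ofReal (Real.exp (-Φ x - c₀)) < ⊤ :=
    Eventually.of_forall fun _ => ENNReal.ofReal_lt_top
  have hsmul : ∀ f g : EuclideanSpace ℝ (Fin n) → ℝ, (fun x =>
      (ENNReal.ofReal (Real.exp (-Φ x - c₀))).toReal • (f x * Real.exp (g x))) =
      fun x => f x * gibbsDensity Φ c₀ g x := fun f g => funext fun x => by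
    rw [ENNReal.toReal_ofReal (Real.exp_pos _).le, gibbsDensity, smul_eq_mul,
      show g x - Φ x - c₀ = -Φ x - c₀ + g x by ring, Real.exp_add]
    ring
  have hInt : ∀ f g : EuclideanSpace ℝ (Fin n) → ℝ,
      Integrable (fun x => f x * Real.exp (g x)) μ ↔
        Integrable fun x => f x * gibbsDensity Φ c₀ g x := fun f g => by
    rw [hμ, integrable_withDensity_iff_integrable_smul' hm htop, hsmul]
  have hintegral : ∀ f g : EuclideanSpace ℝ (Fin n) → ℝ,
      ∫ x, f x * Real.exp (g x) ∂μ = ∫ x, f x * gibbsDensity Φ c₀ g x := fun f g => by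
    rw [hμ, integral_withDensity_eq_integral_toReal_smul hm htop, hsmul]
  obtain ⟨D, D', hD, hD', hlarge⟩ := h.exists_integral_mul_le hA.le c₀
  obtain ⟨C₂, c, hC₂, hc, hsmall⟩ := h.exists_integral_mul_lt_one hA.le c₀ hmass
  refine ⟨D / c + D', C₂, by positivity, by linarith, fun g hg hg1 hg2 hg3 hg4 hent => ?_⟩
  have hfun : (fun x => Real.exp (g x) * Real.log (Real.exp (g x) / ∫ y, Real.exp (g y) ∂μ)) =
      fun x => g x * Real.exp (g x) := by
    simp only [hg2, div_one, Real.log_exp, mul_comm]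
  rw [hfun] at hg3
  rw [Ent, hfun, hintegral] at hent ⊢
  rw [hintegral]
  have hadm : IsAdmissible Φ c₀ C₂ g := by
    refine ⟨hg, ?_, ?_, (hInt _ _).1 hg3, (hInt _ _).1 hg4⟩
    · simpa using (hInt (fun _ => 1) g).1 (by simpa using hg1)
    · rw [← hg2]
      simpa using (hintegral (fun _ => 1) g).symm
  change _ ≤ (D / c + D') * gibbsEnergy Φ c₀ C₂ g
  have hlt : c < gibbsEnergy Φ c₀ C₂ g := by
    by_contra! hcon
    linarith [hsmall g hadm hcon]
  have hDc : D ≤ D / c * gibbsEnergy Φ c₀ C₂ g := by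
    rw [div_mul_eq_mul_div, le_div_iff₀ hc]
    gcongr
  linarith [hlarge C₂ g hC₂ hadm]
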